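/- arXiv:1811.04218 — 3 statements merged into one kernel-verified Lean document; each statement's English description precedes it below -/
import Mathlib

section
/- (Interpolation inequality for the Petz amalgamated norm, classical-quantum case.) Let A_1,…,A_n be positive semidefinite d×d complex matrices, let p_0, p_1 ∈ (1,∞), θ ∈ [0,1], and define p by 1/p = (1−θ)/p_0 + θ/p_1. Then Tr[(Σ_i A_i^p)^{1/p}] ≤ Tr[(Σ_i A_i^{p_0})^{1/p_0}]^{1−θ} · Tr[(Σ_i A_i^{p_1})^{1/p_1}]^{θ}. -/
open Matrix
open scoped ComplexOrder

/-- Real power of a (hermitian) matrix via the continuous functional calculus. -/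
noncomputable def mpow {ι : Type*} [Fintype ι] [DecidableEq ι]
    (A : Matrix ι ι ℂ) (r : ℝ) : Matrix ι ι ℂ :=
  cfc (fun x : ℝ => x ^ r) A

/-- Logarithm of a (hermitian) matrix via the continuous functional calculus. -/
noncomputable def mlog {ι : Type*} [Fintype ι] [DecidableEq ι]
    (A : Matrix ι ι ℂ) : Matrix ι ι ℂ :=
  cfc Real.log A

/-- Real part of the trace. -/
noncomputable def trR {ι : Type*} [Fintype ι] (A : Matrix ι ι ℂ) : ℝ :=
  (Matrix.trace A).re

/-- Positive definite density matrices. -/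
def Dens (d : ℕ) : Type :=
  {σ : Matrix (Fin d) (Fin d) ℂ // σ.PosDef ∧ σ.trace = 1}

namespace PetzInterpolation

/-- Diagonalization of a positive semidefinite matrix with decreasing eigenvalues (extended to a
sequence), compatible with the functional calculus. -/
lemma exists_antitone_diagonalization {d : ℕ} {A : Matrix (Fin d) (Fin d) ℂ}
    (hA : A.PosSemidef) :
    ∃ (U : Matrix (Fin d) (Fin d) ℂ) (β : ℕ → ℝ), Antitone β ∧ (∀ i, 0 ≤ β i) ∧
      Uᴴ * U = 1 ∧ ∀ f : ℝ → ℝ,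
        cfc f A = U * diagonal (fun i : Fin d => ((f (β i) : ℝ) : ℂ)) * Uᴴ := by
  have hH := hA.isHermitian
  let σ : Equiv.Perm (Fin d) := Tuple.sort (fun i => -hH.eigenvalues i)
  have hσ : Antitone (hH.eigenvalues ∘ σ) := fun i j hij => by
    have := Tuple.monotone_sort (fun i => -hH.eigenvalues i) hij
    simpa [σ] using this
  let V : Matrix (Fin d) (Fin d) ℂ := hH.eigenvectorUnitary
  have hV : Vᴴ * V = 1 := by
    simpa [V, star_eq_conjTranspose] using Unitary.coe_star_mul_self hH.eigenvectorUnitary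
  let β : ℕ → ℝ := fun i => if h : i < d then hH.eigenvalues (σ ⟨i, h⟩) else 0
  have hβ : ∀ i : Fin d, β i = hH.eigenvalues (σ i) := fun i => by simp [β]
  refine ⟨V.submatrix id σ, β, ?_, ?_, ?_, ?_⟩
  · intro i j hij
    dsimp only [β]
    split_ifs with h₁ h₂
    · exact hσ (show (⟨i, h₂⟩ : Fin d) ≤ ⟨j, h₁⟩ from hij)
    · omega
    · exact hA.eigenvalues_nonneg _
    · exact le_rfl
  · intro i
    dsimp only [β]
    split_ifs
    · exact hA.eigenvalues_nonneg _
    · exact le_rfl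
  · rw [conjTranspose_submatrix, ← submatrix_mul Vᴴ V σ id σ Function.bijective_id, hV]
    simp
  · intro f
    have h1 : cfc f A =
        V * diagonal (fun i => ((f (hH.eigenvalues i) : ℝ) : ℂ)) * Vᴴ := by
      rw [hH.cfc_eq, IsHermitian.cfc, Unitary.conjStarAlgAut_apply]
      rfl
    ext a b
    rw [h1, mul_apply, mul_apply, ← Equiv.sum_comp σ]
    simp only [mul_diagonal, hβ, conjTranspose_apply, submatrix_apply, id]

/-- Cauchy–Binet expansion of a congruence of a diagonal matrix. -/
lemma exists_det_mul_diagonal_mul_conjTranspose {k : ℕ} {m : Type*} [Fintype m] [DecidableEq m]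
    (Y : Matrix (Fin k) m ℂ) :
    ∃ w : (Fin k → m) → ℝ, (∀ f, 0 ≤ w f) ∧ (∀ f, ¬ Function.Injective f → w f = 0) ∧
      ∀ D : m → ℝ, (Y * diagonal (fun i => (D i : ℂ)) * Yᴴ).det =
        ((∑ f, w f * ∏ j, D (f j) : ℝ) : ℂ) := by
  refine ⟨fun f => ‖(Y.submatrix id f).det‖ ^ 2 / (k.factorial : ℝ), fun f => by positivity,
    fun f hf => ?_, fun D => ?_⟩
  · obtain ⟨i, j, hij, hne⟩ : ∃ i j, f i = f j ∧ i ≠ j := by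
      simpa [Function.Injective] using hf
    have : (Y.submatrix id f).det = 0 := det_zero_of_column_eq hne fun r => by simp [hij]
    simp [this]
  set T : (Fin k → m) → ℂ := fun f =>
    (Y.submatrix id f).det * ∏ j, ((D (f j) : ℂ) * star (Y j (f j))) with hT
  have h1 : (Y * diagonal (fun i => (D i : ℂ)) * Yᴴ).det = ∑ f, T f := by
    have he : ∀ a b, (Y * diagonal (fun i => (D i : ℂ)) * Yᴴ) a b =
        ∑ i, Y a i * D i * star (Y b i) := fun a b => by
      rw [mul_apply]
      simp only [mul_diagonal, conjTranspose_apply]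
    simp only [hT, det_apply', he, Finset.prod_univ_sum, Finset.mul_sum,
      Fintype.piFinset_univ, Finset.sum_mul, submatrix_apply, id]
    rw [Finset.sum_comm]
    simp only [Finset.prod_mul_distrib, mul_assoc]
  have h2 : ∀ σ : Equiv.Perm (Fin k), ∑ f, T f = ∑ f, T (f ∘ σ) := fun σ =>
    (Equiv.sum_comp (Equiv.arrowCongr σ.symm (Equiv.refl m)) T).symm
  have h3 : ∀ f, ∑ σ : Equiv.Perm (Fin k), T (f ∘ σ) =
      ((‖(Y.submatrix id f).det‖ ^ 2 * ∏ j, D (f j) : ℝ) : ℂ) := by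
    intro f
    have hs : ∀ σ : Equiv.Perm (Fin k), T (f ∘ σ) =
        (Y.submatrix id f).det * (∏ j, (D (f j) : ℂ)) *
          (((Equiv.Perm.sign σ : ℤ) : ℂ) * ∏ j, (Y.submatrix id f)ᴴ (σ j) j) := by
      intro σ
      have e1 : Y.submatrix id (f ∘ σ) = (Y.submatrix id f).submatrix id σ := rfl
      simp only [hT, e1, det_permute', Finset.prod_mul_distrib, Function.comp_apply,
        conjTranspose_apply, submatrix_apply, id]
      rw [Equiv.prod_comp σ (fun j => (D (f j) : ℂ))]
      ring
    simp only [hs]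
    rw [← Finset.mul_sum, ← det_apply', det_conjTranspose]
    push_cast
    rw [← Complex.mul_conj', starRingEnd_apply]
    ring
  have h4 : (k.factorial : ℂ) * ∑ f, T f =
      ∑ f, ((‖(Y.submatrix id f).det‖ ^ 2 * ∏ j, D (f j) : ℝ) : ℂ) := by
    rw [← Finset.sum_congr rfl fun f _ => h3 f, Finset.sum_comm,
      ← Finset.sum_congr rfl fun σ _ => h2 σ]
    simp [Fintype.card_perm]
  have hk : (k.factorial : ℂ) ≠ 0 := by exact_mod_cast k.factorial_ne_zero
  rw [h1, ← mul_right_inj' hk, h4]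
  push_cast
  rw [Finset.mul_sum]
  refine Finset.sum_congr rfl fun f _ => ?_
  field_simp

/-- Hölder's inequality for weighted geometric means. -/
lemma sum_rpow_mul_rpow_le {ι : Type*} (s : Finset ι) {u v : ι → ℝ} (hu : ∀ i, 0 ≤ u i)
    (hv : ∀ i, 0 ≤ v i) {t : ℝ} (ht₀ : 0 < t) (ht₁ : t < 1) :
    ∑ i ∈ s, u i ^ (1 - t) * v i ^ t ≤ (∑ i ∈ s, u i) ^ (1 - t) * (∑ i ∈ s, v i) ^ t := by
  have h1 : 0 < 1 - t := by linarith
  have hpq : (1 - t)⁻¹.HolderConjugate t⁻¹ := by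
    rw [Real.holderConjugate_iff]
    exact ⟨(one_lt_inv₀ h1).2 (by linarith), by simp⟩
  have := Real.inner_le_Lp_mul_Lq_of_nonneg s hpq (f := fun i => u i ^ (1 - t))
    (g := fun i => v i ^ t) (fun i _ => Real.rpow_nonneg (hu i) _)
    (fun i _ => Real.rpow_nonneg (hv i) _)
  simpa [← Real.rpow_mul, hu, hv, h1.ne', ht₀.ne'] using this

lemma prod_le_prod_range_of_injective {β : ℕ → ℝ} (hβ : Antitone β) (hβ₀ : ∀ i, 0 ≤ β i)
    {k : ℕ} {f : Fin k → ℕ} (hf : Function.Injective f) :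
    ∏ j, β (f j) ≤ ∏ j ∈ Finset.range k, β j := by
  let s : Finset ℕ := Finset.univ.image f
  have hs : s.card = k := by simp [s, Finset.card_image_of_injective _ hf]
  let e := s.orderEmbOfFin hs
  have he : ∀ i (h : i < k), i ≤ e ⟨i, h⟩ := by
    intro i
    induction i with
    | zero => exact fun _ => Nat.zero_le _
    | succ i ih =>
      intro h
      have h' : e ⟨i, by omega⟩ < e ⟨i + 1, h⟩ := e.strictMono (by simp [Fin.lt_def])
      have := ih (by omega)
      omega
  have h1 : ∏ j, β (f j) = ∏ x ∈ s, β x := by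
    rw [Finset.prod_image fun a _ b _ h => hf h]
  have h2 : ∏ x ∈ s, β x = ∏ j, β (e j) := by
    have : s = Finset.univ.map e.toEmbedding := (Finset.map_orderEmbOfFin_univ s hs).symm
    conv_lhs => rw [this]
    rw [Finset.prod_map]
    rfl
  rw [h1, h2, Finset.prod_range]
  exact Finset.prod_le_prod (fun _ _ => hβ₀ _) fun j _ => hβ (he j j.2)

/-- Abel summation: if all partial sums are nonnegative, then replacing decreasing weights by the
last one decreases the sum. -/
lemma mul_sum_le_sum_mul_of_antitone {w z : ℕ → ℝ} (hw : Antitone w) (n : ℕ)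
    (hz : ∀ k ≤ n, 0 ≤ ∑ j ∈ Finset.range k, z j) :
    w (n - 1) * ∑ j ∈ Finset.range n, z j ≤ ∑ j ∈ Finset.range n, w j * z j := by
  induction n with
  | zero => simp
  | succ n ih =>
    rw [Finset.sum_range_succ, Finset.sum_range_succ, Nat.add_sub_cancel, mul_add]
    have h1 := ih fun k hk => hz k (by omega)
    have h2 := mul_le_mul_of_nonneg_right (hw (Nat.sub_le n 1)) (hz n (by omega))
    linarith

/-- Weak log-majorization implies weak majorization. -/
lemma sum_le_sum_of_prod_le_prod {x y : ℕ → ℝ} (hx : Antitone x) (hx₀ : ∀ i, 0 ≤ x i)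
    (hy₀ : ∀ i, 0 ≤ y i) (n : ℕ)
    (h : ∀ k ≤ n, ∏ j ∈ Finset.range k, x j ≤ ∏ j ∈ Finset.range k, y j) :
    ∑ j ∈ Finset.range n, x j ≤ ∑ j ∈ Finset.range n, y j := by
  induction n with
  | zero => simp
  | succ n ih =>
    rcases (hx₀ n).eq_or_lt with hn | hn
    · rw [Finset.sum_range_succ, Finset.sum_range_succ, ← hn]
      exact add_le_add (ih fun k hk => h k (by omega)) (hy₀ n)
    have hxp : ∀ j ∈ Finset.range (n + 1), 0 < x j := fun j hj =>
      hn.trans_le (hx (by simp at hj; omega))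
    have hyp : ∀ j ∈ Finset.range (n + 1), 0 < y j := by
      have := (Finset.prod_pos hxp).trans_le (h _ le_rfl)
      exact fun j hj => (hy₀ j).lt_of_ne' (Finset.prod_ne_zero_iff.1 this.ne' j hj)
    have hz : ∀ k ≤ n + 1, 0 ≤ ∑ j ∈ Finset.range k, (Real.log (y j) - Real.log (x j)) := by
      intro k hk
      have hsub : ∀ j ∈ Finset.range k, j ∈ Finset.range (n + 1) := fun j hj => by
        simp at hj ⊢; omega
      rw [Finset.sum_sub_distrib, ← Real.log_prod fun j hj => (hyp j (hsub j hj)).ne',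
        ← Real.log_prod fun j hj => (hxp j (hsub j hj)).ne', sub_nonneg]
      exact Real.log_le_log (Finset.prod_pos fun j hj => hxp j (hsub j hj)) (h k hk)
    have h1 := mul_sum_le_sum_mul_of_antitone hx (n + 1) hz
    have h2 : 0 ≤ x (n + 1 - 1) *
        ∑ j ∈ Finset.range (n + 1), (Real.log (y j) - Real.log (x j)) :=
      mul_nonneg (hx₀ _) (hz _ le_rfl)
    rw [← sub_nonneg, ← Finset.sum_sub_distrib]
    refine (h2.trans h1).trans (Finset.sum_le_sum fun j hj => ?_)
    have hxj := hxp j hj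
    have hyj := hyp j hj
    rw [← Real.log_div hyj.ne' hxj.ne']
    have := mul_le_mul_of_nonneg_left
      (Real.log_le_sub_one_of_pos (div_pos hyj hxj)) hxj.le
    calc _ ≤ _ := this
      _ = _ := by field_simp

/-- The determinant of a compression of a positive semidefinite matrix is at most the product of its
largest eigenvalues. -/
lemma det_compression_le {k d : ℕ} {M : Matrix (Fin k) (Fin d) ℂ} (hM : M * Mᴴ = 1)
    {β : ℕ → ℝ} (hβ : Antitone β) (hβ₀ : ∀ i, 0 ≤ β i) :
    (M * diagonal (fun i : Fin d => (β i : ℂ)) * Mᴴ).det.re ≤ ∏ j ∈ Finset.range k, β j := by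
  obtain ⟨w, hw₀, hw, hdet⟩ := exists_det_mul_diagonal_mul_conjTranspose M
  have h1 : ∑ f, w f = 1 := by
    have := hdet fun _ => 1
    simp only [Complex.ofReal_one, diagonal_one, Matrix.mul_one, hM, det_one, Finset.prod_const_one,
      mul_one] at this
    exact_mod_cast this.symm
  rw [hdet fun i => β i, Complex.ofReal_re, ← one_mul (∏ j ∈ Finset.range k, β j), ← h1,
    Finset.sum_mul]
  refine Finset.sum_le_sum fun f _ => ?_
  by_cases hf : Function.Injective f
  · exact mul_le_mul_of_nonneg_left
      (prod_le_prod_range_of_injective hβ hβ₀ (Fin.val_injective.comp hf)) (hw₀ f)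
  · simp [hw f hf]

/-- Log-convexity of the determinant of `Y * diagonal (a ^ p) * Yᴴ` in the exponent. -/
lemma det_mul_diagonal_rpow_le {k : ℕ} {m : Type*} [Fintype m] [DecidableEq m]
    (Y : Matrix (Fin k) m ℂ) {a : m → ℝ} (ha : ∀ i, 0 ≤ a i) {p p₀ p₁ t : ℝ} (hp₀ : 0 < p₀)
    (hp₁ : 0 < p₁) (ht₀ : 0 < t) (ht₁ : t < 1) (hp : p = p₀ * (1 - t) + p₁ * t)
    {b₀ b₁ : ℝ}
    (h₀ : (Y * diagonal (fun i => ((a i ^ p₀ : ℝ) : ℂ)) * Yᴴ).det.re ≤ b₀)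
    (h₁ : (Y * diagonal (fun i => ((a i ^ p₁ : ℝ) : ℂ)) * Yᴴ).det.re ≤ b₁) :
    (Y * diagonal (fun i => ((a i ^ p : ℝ) : ℂ)) * Yᴴ).det.re ≤ b₀ ^ (1 - t) * b₁ ^ t := by
  obtain ⟨w, hw₀, -, hdet⟩ := exists_det_mul_diagonal_mul_conjTranspose Y
  rw [hdet fun i => a i ^ p₀, Complex.ofReal_re] at h₀
  rw [hdet fun i => a i ^ p₁, Complex.ofReal_re] at h₁
  rw [hdet fun i => a i ^ p, Complex.ofReal_re]
  have hnn : ∀ (q : ℝ) (f : Fin k → m), 0 ≤ w f * ∏ j, a (f j) ^ q := fun q f =>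
    mul_nonneg (hw₀ f) (Finset.prod_nonneg fun j _ => Real.rpow_nonneg (ha _) _)
  have ht : 0 < 1 - t := by linarith
  calc ∑ f, w f * ∏ j, a (f j) ^ p
      = ∑ f, (w f * ∏ j, a (f j) ^ p₀) ^ (1 - t) * (w f * ∏ j, a (f j) ^ p₁) ^ t := by
        refine Finset.sum_congr rfl fun f _ => ?_
        have hpr : ∀ q : ℝ, 0 ≤ ∏ j, a (f j) ^ q := fun q =>
          Finset.prod_nonneg fun j _ => Real.rpow_nonneg (ha _) _
        have hw : w f = w f ^ (1 - t) * w f ^ t := by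
          rw [← Real.rpow_add_of_nonneg (hw₀ f) ht.le ht₀.le, sub_add_cancel, Real.rpow_one]
        rw [Real.mul_rpow (hw₀ f) (hpr _), Real.mul_rpow (hw₀ f) (hpr _), mul_mul_mul_comm, ← hw,
          ← Real.finsetProd_rpow _ _ fun j _ => Real.rpow_nonneg (ha _) _,
          ← Real.finsetProd_rpow _ _ fun j _ => Real.rpow_nonneg (ha _) _,
          ← Finset.prod_mul_distrib]
        congr 1
        refine Finset.prod_congr rfl fun j _ => ?_
        rw [← Real.rpow_mul (ha _), ← Real.rpow_mul (ha _),
          ← Real.rpow_add_of_nonneg (ha _) (by positivity) (by positivity), hp]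
    _ ≤ (∑ f, w f * ∏ j, a (f j) ^ p₀) ^ (1 - t) * (∑ f, w f * ∏ j, a (f j) ^ p₁) ^ t :=
        sum_rpow_mul_rpow_le _ (hnn p₀) (hnn p₁) ht₀ ht₁
    _ ≤ b₀ ^ (1 - t) * b₁ ^ t := by
        have e₀ := Finset.sum_nonneg fun f (_ : f ∈ Finset.univ) => hnn p₀ f
        have e₁ := Finset.sum_nonneg fun f (_ : f ∈ Finset.univ) => hnn p₁ f
        have := e₀.trans h₀
        gcongr

lemma conjTranspose_mul_congr {d k : ℕ} {m : Type*} [Fintype m] (V : Matrix (Fin d) (Fin k) ℂ)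
    (Z : Matrix (Fin d) m ℂ) (D : Matrix m m ℂ) :
    Vᴴ * Z * D * (Vᴴ * Z)ᴴ = Vᴴ * (Z * D * Zᴴ) * V := by
  simp only [conjTranspose_mul, conjTranspose_conjTranspose, Matrix.mul_assoc]

/-- Log-majorization for the eigenvalues of `X * diagonal (a ^ p) * Xᴴ` as the exponent varies. -/
lemma prod_eigenvalues_le {d : ℕ} {m : Type*} [Fintype m] [DecidableEq m]
    (X : Matrix (Fin d) m ℂ) {a : m → ℝ} (ha : ∀ i, 0 ≤ a i) {p p₀ p₁ t : ℝ} (hp₀ : 0 < p₀)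
    (hp₁ : 0 < p₁) (ht₀ : 0 < t) (ht₁ : t < 1) (hp : p = p₀ * (1 - t) + p₁ * t)
    {U U₀ U₁ : Matrix (Fin d) (Fin d) ℂ} {β β₀ β₁ : ℕ → ℝ}
    (hU : Uᴴ * U = 1) (hU₀ : U₀ᴴ * U₀ = 1) (hU₁ : U₁ᴴ * U₁ = 1)
    (hβ₀ : Antitone β₀) (hβ₁ : Antitone β₁) (hβ₀' : ∀ i, 0 ≤ β₀ i) (hβ₁' : ∀ i, 0 ≤ β₁ i)
    (h : X * diagonal (fun i => ((a i ^ p : ℝ) : ℂ)) * Xᴴ =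
      U * diagonal (fun i : Fin d => (β i : ℂ)) * Uᴴ)
    (h₀ : X * diagonal (fun i => ((a i ^ p₀ : ℝ) : ℂ)) * Xᴴ =
      U₀ * diagonal (fun i : Fin d => (β₀ i : ℂ)) * U₀ᴴ)
    (h₁ : X * diagonal (fun i => ((a i ^ p₁ : ℝ) : ℂ)) * Xᴴ =
      U₁ * diagonal (fun i : Fin d => (β₁ i : ℂ)) * U₁ᴴ)
    {k : ℕ} (hk : k ≤ d) :
    ∏ j ∈ Finset.range k, β j ≤
      (∏ j ∈ Finset.range k, β₀ j) ^ (1 - t) * (∏ j ∈ Finset.range k, β₁ j) ^ t := by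
  let V : Matrix (Fin d) (Fin k) ℂ := U.submatrix id (Fin.castLE hk)
  have hVV : Vᴴ * V = 1 := by
    have : Vᴴ * V = (Uᴴ * U).submatrix (Fin.castLE hk) (Fin.castLE hk) := rfl
    rw [this, hU, submatrix_one _ (Fin.castLE_injective hk)]
  have hM : ∀ {Z : Matrix (Fin d) (Fin d) ℂ}, Zᴴ * Z = 1 → Vᴴ * Z * (Vᴴ * Z)ᴴ = 1 := by
    intro Z hZ
    have := conjTranspose_mul_congr V Z 1
    rwa [Matrix.mul_one, Matrix.mul_one, mul_eq_one_comm.1 hZ, Matrix.mul_one, hVV] at this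
  have hdet : (Vᴴ * X * diagonal (fun i => ((a i ^ p : ℝ) : ℂ)) * (Vᴴ * X)ᴴ).det.re =
      ∏ j ∈ Finset.range k, β j := by
    have hdiag : Vᴴ * U * diagonal (fun i : Fin d => (β i : ℂ)) * (Vᴴ * U)ᴴ =
        diagonal fun i : Fin k => (β i : ℂ) := by
      have hsub : Vᴴ * U * diagonal (fun i : Fin d => (β i : ℂ)) * (Vᴴ * U)ᴴ =
          (Uᴴ * U * diagonal (fun i : Fin d => (β i : ℂ)) * (Uᴴ * U)ᴴ).submatrix
            (Fin.castLE hk) (Fin.castLE hk) := rfl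
      rw [hsub, hU, conjTranspose_one, Matrix.one_mul, Matrix.mul_one,
        submatrix_diagonal _ _ (Fin.castLE_injective hk)]
      rfl
    rw [conjTranspose_mul_congr, h, ← conjTranspose_mul_congr, hdiag, det_diagonal, Finset.prod_range, ← Complex.ofReal_prod,
      Complex.ofReal_re]
  rw [← hdet]
  refine det_mul_diagonal_rpow_le _ ha hp₀ hp₁ ht₀ ht₁ hp ?_ ?_
  · rw [conjTranspose_mul_congr, h₀, ← conjTranspose_mul_congr]
    exact det_compression_le (hM hU₀) hβ₀ hβ₀'
  · rw [conjTranspose_mul_congr, h₁, ← conjTranspose_mul_congr]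
    exact det_compression_le (hM hU₁) hβ₁ hβ₁'

lemma trR_mul_diagonal_mul_conjTranspose {d : ℕ} {U : Matrix (Fin d) (Fin d) ℂ}
    (hU : Uᴴ * U = 1) (β : ℕ → ℝ) :
    trR (U * diagonal (fun i : Fin d => (β i : ℂ)) * Uᴴ) = ∑ j ∈ Finset.range d, β j := by
  rw [trR, trace_mul_comm, ← Matrix.mul_assoc, hU, Matrix.one_mul, trace_diagonal,
    ← Complex.ofReal_sum, Complex.ofReal_re, Finset.sum_range]

/-- A sum of powers of positive semidefinite matrices as a simultaneous congruence of diagonal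
matrices. -/
lemma exists_sum_mpow_eq {d n : ℕ} {A : Fin n → Matrix (Fin d) (Fin d) ℂ}
    (hA : ∀ i, (A i).PosSemidef) :
    ∃ (X : Matrix (Fin d) (Fin n × Fin d) ℂ) (a : Fin n × Fin d → ℝ), (∀ i, 0 ≤ a i) ∧
      ∀ q : ℝ, ∑ i, mpow (A i) q = X * diagonal (fun i => ((a i ^ q : ℝ) : ℂ)) * Xᴴ := by
  choose U α _ hα₀ _ hα using fun i => exists_antitone_diagonalization (hA i)
  refine ⟨of fun r x => U x.1 r x.2, fun x => α x.1 x.2, fun x => hα₀ _ _, fun q => ?_⟩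
  ext r s
  rw [Matrix.sum_apply, mul_apply, Fintype.sum_prod_type]
  refine Finset.sum_congr rfl fun i _ => ?_
  rw [mpow, hα i, mul_apply]
  simp only [mul_diagonal, conjTranspose_apply, of_apply]

end PetzInterpolation


/-- interpolation inequality for the Petz amalgamated norm
(classical-quantum case). -/
theorem petz_interpolation_inequality {d n : ℕ} (hd : 0 < d) (hn : 0 < n)
    (A : Fin n → Matrix (Fin d) (Fin d) ℂ)
    (hA : ∀ i, (A i).PosSemidef)
    (p₀ p₁ p θ : ℝ) (hp₀ : 1 < p₀) (hp₁ : 1 < p₁)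
    (hθ : θ ∈ Set.Icc (0 : ℝ) 1)
    (hp : 1 / p = (1 - θ) / p₀ + θ / p₁) :
    trR (mpow (∑ i, mpow (A i) p) (1 / p)) ≤
      trR (mpow (∑ i, mpow (A i) p₀) (1 / p₀)) ^ (1 - θ) *
        trR (mpow (∑ i, mpow (A i) p₁) (1 / p₁)) ^ θ := by
  have hp₀' : 0 < p₀ := by linarith
  have hp₁' : 0 < p₁ := by linarith
  rcases hθ.1.eq_or_lt with h0 | hθ₀
  · subst h0
    obtain rfl : p = p₀ := by simpa using hp
    simp
  rcases hθ.2.eq_or_lt with h1 | hθ₁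
  · subst h1
    obtain rfl : p = p₁ := by simpa using hp
    simp
  have hθ' : 0 < 1 - θ := by linarith
  have hp' : 0 < p := by
    rw [← one_div_pos, hp]
    positivity
  obtain ⟨X, a, ha, hX⟩ := PetzInterpolation.exists_sum_mpow_eq hA
  have hpsd : ∀ q : ℝ, (∑ i, mpow (A i) q).PosSemidef := fun q => by
    rw [hX]
    refine PosSemidef.mul_mul_conjTranspose_same (PosSemidef.diagonal fun i => ?_) X
    exact Complex.zero_le_real.2 (Real.rpow_nonneg (ha i) q)
  obtain ⟨U, β, hβ, hβn, hU, hcfc⟩ := PetzInterpolation.exists_antitone_diagonalization (hpsd p)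
  obtain ⟨U₀, β₀, hβ₀, hβn₀, hU₀, hcfc₀⟩ :=
    PetzInterpolation.exists_antitone_diagonalization (hpsd p₀)
  obtain ⟨U₁, β₁, hβ₁, hβn₁, hU₁, hcfc₁⟩ :=
    PetzInterpolation.exists_antitone_diagonalization (hpsd p₁)
  have hid : ∀ q : ℝ, cfc (fun x : ℝ => x) (∑ i, mpow (A i) q) =
      X * diagonal (fun i => ((a i ^ q : ℝ) : ℂ)) * Xᴴ := fun q => by
    rw [cfc_id' ℝ _ (hpsd q).isHermitian.isSelfAdjoint, hX]
  have hsum : θ * p / p₁ = 1 - (1 - θ) * p / p₀ := by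
    have : p * (1 / p) = 1 := by field_simp
    rw [hp] at this
    linear_combination this
  set t := θ * p / p₁ with ht
  have ht' : 1 - t = (1 - θ) * p / p₀ := by linarith
  have ht₀ : 0 < t := by positivity
  have ht₁ : 0 < 1 - t := by rw [ht']; positivity
  have hpt : p = p₀ * (1 - t) + p₁ * t := by
    rw [ht', ht]
    field_simp
    ring
  have hmaj : ∀ k ≤ d, ∏ j ∈ Finset.range k, β j ≤
      (∏ j ∈ Finset.range k, β₀ j) ^ (1 - t) * (∏ j ∈ Finset.range k, β₁ j) ^ t := fun k hk =>
    PetzInterpolation.prod_eigenvalues_le X ha hp₀' hp₁' ht₀ (by linarith) hpt hU hU₀ hU₁ hβ₀ hβ₁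
      hβn₀ hβn₁ ((hid p).symm.trans (hcfc _)) ((hid p₀).symm.trans (hcfc₀ _))
      ((hid p₁).symm.trans (hcfc₁ _)) hk
  have htr : ∀ {q : ℝ} {W : Matrix (Fin d) (Fin d) ℂ} {γ : ℕ → ℝ}, Wᴴ * W = 1 →
      (∀ f : ℝ → ℝ, cfc f (∑ i, mpow (A i) q) =
        W * diagonal (fun i : Fin d => ((f (γ i) : ℝ) : ℂ)) * Wᴴ) →
      trR (mpow (∑ i, mpow (A i) q) (1 / q)) = ∑ j ∈ Finset.range d, γ j ^ (1 / q) := by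
    intro q W γ hW h
    rw [mpow, h, PetzInterpolation.trR_mul_diagonal_mul_conjTranspose hW fun i => γ i ^ (1 / q)]
  rw [htr hU hcfc, htr hU₀ hcfc₀, htr hU₁ hcfc₁]
  have hn₀ : ∀ j, 0 ≤ β₀ j ^ (1 / p₀) := fun j => Real.rpow_nonneg (hβn₀ j) _
  have hn₁ : ∀ j, 0 ≤ β₁ j ^ (1 / p₁) := fun j => Real.rpow_nonneg (hβn₁ j) _
  refine le_trans ?_ (PetzInterpolation.sum_rpow_mul_rpow_le _ hn₀ hn₁ hθ₀ hθ₁)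
  refine PetzInterpolation.sum_le_sum_of_prod_le_prod
    (fun i j hij => Real.rpow_le_rpow (hβn j) (hβ hij) (by positivity))
    (fun j => Real.rpow_nonneg (hβn j) _)
    (fun j => mul_nonneg (Real.rpow_nonneg (hn₀ j) _) (Real.rpow_nonneg (hn₁ j) _)) d
    fun k hk => ?_
  have hP₀ : 0 ≤ ∏ j ∈ Finset.range k, β₀ j := Finset.prod_nonneg fun j _ => hβn₀ j
  have hP₁ : 0 ≤ ∏ j ∈ Finset.range k, β₁ j := Finset.prod_nonneg fun j _ => hβn₁ j
  rw [Finset.prod_mul_distrib, Real.finsetProd_rpow _ _ fun j _ => hβn j,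
    Real.finsetProd_rpow _ _ fun j _ => hn₀ j, Real.finsetProd_rpow _ _ fun j _ => hn₁ j,
    Real.finsetProd_rpow _ _ fun j _ => hβn₀ j, Real.finsetProd_rpow _ _ fun j _ => hβn₁ j]
  refine (Real.rpow_le_rpow (Finset.prod_nonneg fun j _ => hβn j) (hmaj k hk)
    (by positivity)).trans_eq ?_
  rw [Real.mul_rpow (Real.rpow_nonneg hP₀ _) (Real.rpow_nonneg hP₁ _), ← Real.rpow_mul hP₀,
    ← Real.rpow_mul hP₁, ← Real.rpow_mul hP₀, ← Real.rpow_mul hP₁, ht', ht]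
  congr 2 <;> field_simp
end

section
/- (Concavity of the Petz Rényi auxiliary function E_0^{(1)}(s,P) on (−1,0).) The map s ↦ −log Tr[(Σ_i P(i)·W_i^{1/(1+s)})^{1+s}] is concave on the interval (−1,0). -/
open Matrix
open scoped ComplexOrder

namespace PetzRenyi

open Finset MeasureTheory

section

variable {ι κ : Type*} [Fintype ι] [Fintype κ]

/-- The real part of the quadratic form of a matrix. -/
noncomputable def quad (A : Matrix ι ι ℂ) (x : ι → ℂ) : ℝ :=
  (star x ⬝ᵥ (A *ᵥ x)).re

lemma quad_add (A B : Matrix ι ι ℂ) (x : ι → ℂ) : quad (A + B) x = quad A x + quad B x := by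
  simp [quad, add_mulVec]

lemma quad_smul (c : ℝ) (A : Matrix ι ι ℂ) (x : ι → ℂ) : quad (c • A) x = c * quad A x := by
  simp [quad, smul_mulVec]

lemma quad_sum {τ : Type*} (s : Finset τ) (A : τ → Matrix ι ι ℂ) (x : ι → ℂ) :
    quad (∑ i ∈ s, A i) x = ∑ i ∈ s, quad (A i) x := by
  classical
  induction s using Finset.induction_on with
  | empty => simp [quad]
  | insert a s ha ih => rw [sum_insert ha, sum_insert ha, quad_add, ih]

lemma quad_conj (C : Matrix ι κ ℂ) (A : Matrix ι ι ℂ) (x : κ → ℂ) :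
    quad (Cᴴ * A * C) x = quad A (C *ᵥ x) := by
  unfold quad
  rw [star_mulVec, ← mulVec_mulVec, ← mulVec_mulVec, dotProduct_mulVec, dotProduct_mulVec,
    dotProduct_mulVec]

lemma quad_nonneg {A : Matrix ι ι ℂ} (hA : A.PosSemidef) (x : ι → ℂ) : 0 ≤ quad A x :=
  hA.re_dotProduct_nonneg x

lemma quad_le_of_sub {A B : Matrix ι ι ℂ} (h : (B - A).PosSemidef) (x : ι → ℂ) :
    quad A x ≤ quad B x := by
  have h1 := quad_nonneg h x
  have h2 := quad_add (B - A) A x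
  rw [sub_add_cancel] at h2
  linarith

variable [DecidableEq ι]

lemma quad_single (A : Matrix ι ι ℂ) (j : ι) : quad A (Pi.single j 1) = (A j j).re := by
  simp [quad]

lemma quad_diagonal (d : ι → ℝ) (x : ι → ℂ) :
    quad (diagonal (fun j => (d j : ℂ))) x = ∑ j, d j * Complex.normSq (x j) := by
  simp only [quad, dotProduct, mulVec_diagonal, Complex.re_sum, Pi.star_apply]
  refine sum_congr rfl fun j _ => ?_
  simp [Complex.normSq_apply]
  ring

/-- Hölder's inequality for two weighted sums with exponents `1 - l` and `l`. -/
lemma sum_rpow_mul_rpow_le {τ : Type*} (s : Finset τ) (a b : τ → ℝ) (ha : ∀ i ∈ s, 0 ≤ a i)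
    (hb : ∀ i ∈ s, 0 ≤ b i) {l : ℝ} (h0 : 0 < l) (h1 : l < 1) :
    ∑ i ∈ s, a i ^ (1 - l) * b i ^ l ≤ (∑ i ∈ s, a i) ^ (1 - l) * (∑ i ∈ s, b i) ^ l := by
  have hl : 0 < 1 - l := by linarith
  have hpq : (1 - l)⁻¹.HolderConjugate l⁻¹ :=
    Real.HolderConjugate.inv_inv hl h0 (by ring)
  have h := Real.inner_le_Lp_mul_Lq_of_nonneg s hpq (f := fun i => a i ^ (1 - l))
    (g := fun i => b i ^ l) (fun i hi => Real.rpow_nonneg (ha i hi) _)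
    (fun i hi => Real.rpow_nonneg (hb i hi) _)
  rw [sum_congr rfl fun i hi => Real.rpow_rpow_inv (ha i hi) hl.ne',
    sum_congr rfl fun i hi => Real.rpow_rpow_inv (hb i hi) h0.ne'] at h
  simpa using h

lemma cfc_eq_conj_diagonal {A : Matrix ι ι ℂ} (hA : A.IsHermitian) (f : ℝ → ℝ) :
    cfc f A = (hA.eigenvectorUnitary : Matrix ι ι ℂ) *
      diagonal (fun j => ((f (hA.eigenvalues j) : ℝ) : ℂ)) *
      (hA.eigenvectorUnitary : Matrix ι ι ℂ)ᴴ := by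
  rw [hA.cfc_eq, IsHermitian.cfc, Unitary.conjStarAlgAut_apply]
  rfl

lemma eq_conj_diagonal {A : Matrix ι ι ℂ} (hA : A.IsHermitian) :
    A = (hA.eigenvectorUnitary : Matrix ι ι ℂ) *
      diagonal (fun j => (hA.eigenvalues j : ℂ)) *
      (hA.eigenvectorUnitary : Matrix ι ι ℂ)ᴴ := by
  conv_lhs => rw [hA.spectral_theorem, Unitary.conjStarAlgAut_apply]
  rfl

lemma conjTranspose_mul_eigenvectorUnitary {A : Matrix ι ι ℂ} (hA : A.IsHermitian) :
    (hA.eigenvectorUnitary : Matrix ι ι ℂ)ᴴ * (hA.eigenvectorUnitary : Matrix ι ι ℂ) = 1 :=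
  Unitary.coe_star_mul_self _

lemma conjTranspose_mul_mul_eigenvectorUnitary {A : Matrix ι ι ℂ} (hA : A.IsHermitian) :
    (hA.eigenvectorUnitary : Matrix ι ι ℂ)ᴴ * A * (hA.eigenvectorUnitary : Matrix ι ι ℂ) =
      diagonal (fun j => (hA.eigenvalues j : ℂ)) := by
  have hU := conjTranspose_mul_eigenvectorUnitary hA
  conv_lhs => enter [1, 2]; rw [eq_conj_diagonal hA]
  simp only [← mul_assoc, hU, one_mul]
  rw [mul_assoc, hU, mul_one]

lemma quad_cfc {A : Matrix ι ι ℂ} (hA : A.IsHermitian) (f : ℝ → ℝ) (x : ι → ℂ) :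
    quad (cfc f A) x = ∑ j, f (hA.eigenvalues j) *
      Complex.normSq (((hA.eigenvectorUnitary : Matrix ι ι ℂ)ᴴ *ᵥ x) j) := by
  rw [cfc_eq_conj_diagonal hA, ← quad_diagonal (fun j => f (hA.eigenvalues j)), ← quad_conj,
    conjTranspose_conjTranspose]

lemma trR_mpow {A : Matrix ι ι ℂ} (hA : A.IsHermitian) (r : ℝ) :
    trR (mpow A r) = ∑ j, hA.eigenvalues j ^ r := by
  rw [trR, mpow, cfc_eq_conj_diagonal hA, trace_mul_comm, ← mul_assoc,
    conjTranspose_mul_eigenvectorUnitary, one_mul, trace_diagonal, Complex.re_sum]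
  simp

lemma posDef_mpow {A : Matrix ι ι ℂ} (hA : A.PosDef) (r : ℝ) : (mpow A r).PosDef := by
  rw [mpow, cfc_eq_conj_diagonal hA.isHermitian]
  refine PosDef.mul_mul_conjTranspose_same (PosDef.diagonal fun j => ?_) ?_
  · exact_mod_cast Real.rpow_pos_of_pos (hA.eigenvalues_pos j) r
  · intro x y hxy
    have h := congrArg (fun z => z ᵥ* (hA.1.eigenvectorUnitary : Matrix ι ι ℂ)ᴴ) hxy
    have hU : (hA.1.eigenvectorUnitary : Matrix ι ι ℂ) *
      (hA.1.eigenvectorUnitary : Matrix ι ι ℂ)ᴴ = 1 := Unitary.coe_mul_star_self _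
    simpa [vecMul_vecMul, hU] using h

/-- Interpolation of the quadratic forms of averaged powers. -/
lemma quad_sum_mpow_le {n : ℕ} (W : Fin n → Matrix ι ι ℂ) (hW : ∀ i, (W i).PosDef)
    (P : Fin n → ℝ) (hP : ∀ i, 0 ≤ P i) {l : ℝ} (h0 : 0 < l) (h1 : l < 1) (u v : ℝ)
    (x : ι → ℂ) :
    quad (∑ i, P i • mpow (W i) ((1 - l) * u + l * v)) x ≤
      quad (∑ i, P i • mpow (W i) u) x ^ (1 - l) * quad (∑ i, P i • mpow (W i) v) x ^ l := by
  set c : Fin n × ι → ℝ := fun k => P k.1 *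
    Complex.normSq ((((hW k.1).1.eigenvectorUnitary : Matrix ι ι ℂ)ᴴ *ᵥ x) k.2) with hc
  set w : Fin n × ι → ℝ := fun k => (hW k.1).1.eigenvalues k.2 with hw
  have hc0 : ∀ k, 0 ≤ c k := fun k => mul_nonneg (hP _) (Complex.normSq_nonneg _)
  have hw0 : ∀ k, 0 < w k := fun k => (hW k.1).eigenvalues_pos k.2
  have key : ∀ r : ℝ, quad (∑ i, P i • mpow (W i) r) x = ∑ k, c k * w k ^ r := by
    intro r
    rw [quad_sum, Fintype.sum_prod_type]
    refine sum_congr rfl fun i _ => ?_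
    rw [quad_smul, mpow, quad_cfc (hW i).1, mul_sum]
    refine sum_congr rfl fun j _ => ?_
    simp only [hc, hw]
    ring
  rw [key, key, key]
  refine le_trans (le_of_eq (sum_congr rfl fun k _ => ?_)) (sum_rpow_mul_rpow_le univ _ _
    (fun k _ => mul_nonneg (hc0 k) (Real.rpow_nonneg (hw0 k).le u))
    (fun k _ => mul_nonneg (hc0 k) (Real.rpow_nonneg (hw0 k).le v)) h0 h1)
  have hwu := Real.rpow_nonneg (hw0 k).le u
  have hwv := Real.rpow_nonneg (hw0 k).le v
  rw [Real.mul_rpow (hc0 k) hwu, Real.mul_rpow (hc0 k) hwv, ← Real.rpow_mul (hw0 k).le,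
    ← Real.rpow_mul (hw0 k).le, Real.rpow_add (hw0 k), mul_mul_mul_comm (c k ^ (1 - l)),
    ← Real.rpow_add' (hc0 k) (by simp), sub_add_cancel, Real.rpow_one, mul_comm u, mul_comm v]

lemma det_re_le_one {X : Matrix ι ι ℂ} (hX : X.PosSemidef) (h : ∀ i, (X i i).re ≤ 1) :
    X.det.re ≤ 1 := by
  have hdet : X.det.re = ∏ i, hX.1.eigenvalues i := by
    rw [hX.1.det_eq_prod_eigenvalues]
    exact_mod_cast Complex.ofReal_re _
  have htr : ∑ i, hX.1.eigenvalues i = ∑ i, (X i i).re := by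
    have := congrArg Complex.re hX.1.trace_eq_sum_eigenvalues
    simp only [trace, Complex.re_sum, diag_apply] at this
    simpa using this.symm
  rw [hdet]
  calc ∏ i, hX.1.eigenvalues i ≤ ∏ i, Real.exp (hX.1.eigenvalues i - 1) :=
        prod_le_prod (fun i _ => hX.eigenvalues_nonneg i)
          fun i _ => by linarith [Real.add_one_le_exp (hX.1.eigenvalues i - 1)]
    _ = Real.exp (∑ i, hX.1.eigenvalues i - ∑ _i : ι, (1 : ℝ)) := by
        rw [← Real.exp_sum, sum_sub_distrib]
    _ ≤ 1 := Real.exp_le_one_iff.2 (by rw [htr]; linarith [sum_le_sum fun i (_ : i ∈ univ) => h i])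

lemma one_le_det_re {X : Matrix ι ι ℂ} (hX : (X - 1).PosSemidef) : 1 ≤ X.det.re := by
  have hX1 : X.IsHermitian := by simpa using hX.1.add isHermitian_one
  have hdet : X.det.re = ∏ i, hX1.eigenvalues i := by
    rw [hX1.det_eq_prod_eigenvalues]
    exact_mod_cast Complex.ofReal_re _
  rw [hdet]
  have hev : ∀ i, 1 ≤ hX1.eigenvalues i := fun i => by
    have h := (hX.conjTranspose_mul_mul_same (hX1.eigenvectorUnitary : Matrix ι ι ℂ)).diag_nonneg
      (i := i)
    rw [mul_sub, sub_mul, conjTranspose_mul_mul_eigenvectorUnitary, mul_one,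
      conjTranspose_mul_eigenvectorUnitary] at h
    have h2 := (Complex.le_def.1 h).1
    simp at h2
    exact h2
  calc (1 : ℝ) = ∏ _i : ι, (1 : ℝ) := by simp
    _ ≤ _ := prod_le_prod (fun _ _ => zero_le_one) fun i _ => hev i

/-- Pointwise interpolation of quadratic forms implies interpolation of determinants. -/
lemma det_re_le_of_quad_le {A B M : Matrix ι ι ℂ} (hA : A.PosDef) (hB : B.PosDef)
    (hM : M.PosSemidef) {l : ℝ}
    (h : ∀ x, quad M x ≤ quad A x ^ (1 - l) * quad B x ^ l) :
    M.det.re ≤ A.det.re ^ (1 - l) * B.det.re ^ l := by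
  have hre : ∀ (D : ι → ℝ), (diagonal (fun j => (D j : ℂ))).det.re = ∏ j, D j := fun D => by
    rw [det_diagonal]; exact_mod_cast Complex.ofReal_re _
  obtain ⟨C, hCu, hC⟩ : ∃ C : Matrix ι ι ℂ, IsUnit C ∧ Cᴴ * A * C = 1 := by
    set U := (hA.1.eigenvectorUnitary : Matrix ι ι ℂ)
    set E : Matrix ι ι ℂ := diagonal (fun j => (((hA.1.eigenvalues j) ^ (-(1 / 2) : ℝ) : ℝ) : ℂ))
    have hE : Eᴴ * diagonal (fun j => (hA.1.eigenvalues j : ℂ)) * E = 1 := by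
      rw [diagonal_conjTranspose, diagonal_mul_diagonal, diagonal_mul_diagonal, ← diagonal_one]
      congr 1
      funext j
      have hj := hA.eigenvalues_pos j
      simp only [Pi.star_apply, RCLike.star_def, Complex.conj_ofReal]
      norm_cast
      nth_rewrite 2 [← Real.rpow_one (hA.1.eigenvalues j)]
      rw [← Real.rpow_add hj, ← Real.rpow_add hj]
      norm_num
    have hC : (U * E)ᴴ * A * (U * E) = 1 := by
      rw [← hE, ← conjTranspose_mul_mul_eigenvectorUnitary hA.1, conjTranspose_mul]
      simp only [U, mul_assoc]
    exact ⟨U * E, IsUnit.of_mul_eq_one_right _ hC, hC⟩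
  have hB' : (Cᴴ * B * C).PosDef :=
    hB.conjTranspose_mul_mul_same (mulVec_injective_of_isUnit hCu)
  set V := (hB'.1.eigenvectorUnitary : Matrix ι ι ℂ)
  set δ := hB'.1.eigenvalues
  have hδ : ∀ j, 0 < δ j := hB'.eigenvalues_pos
  set E : Matrix ι ι ℂ := diagonal (fun j => ((δ j ^ (-(l / 2)) : ℝ) : ℂ))
  set T := C * V * E with hT
  have hconj : ∀ X : Matrix ι ι ℂ, Tᴴ * X * T = Eᴴ * (Vᴴ * (Cᴴ * X * C) * V) * E := fun X => by
    simp only [hT, conjTranspose_mul, mul_assoc]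
  have hEH : Eᴴ = E := by
    rw [diagonal_conjTranspose]
    congr 1
    funext j
    simp
  have hTA : Tᴴ * A * T = diagonal (fun j => ((δ j ^ (-l) : ℝ) : ℂ)) := by
    rw [hconj, hC, mul_one, conjTranspose_mul_eigenvectorUnitary, mul_one, hEH,
      diagonal_mul_diagonal]
    congr 1
    funext j
    norm_cast
    rw [← Real.rpow_add (hδ j)]
    ring_nf
  have hTB : Tᴴ * B * T = diagonal (fun j => ((δ j ^ (1 - l) : ℝ) : ℂ)) := by
    rw [hconj, conjTranspose_mul_mul_eigenvectorUnitary, hEH,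
      diagonal_mul_diagonal, diagonal_mul_diagonal]
    congr 1
    funext j
    norm_cast
    change δ j ^ (-(l / 2)) * δ j * δ j ^ (-(l / 2)) = _
    nth_rewrite 2 [← Real.rpow_one (δ j)]
    rw [← Real.rpow_add (hδ j), ← Real.rpow_add (hδ j)]
    ring_nf
  have hTM : (Tᴴ * M * T).det.re ≤ 1 := by
    refine det_re_le_one (hM.conjTranspose_mul_mul_same T) fun j => ?_
    rw [← quad_single, quad_conj]
    refine (h _).trans ?_
    rw [← quad_conj, ← quad_conj, hTA, hTB, quad_single, quad_single]
    simp only [diagonal_apply_eq, Complex.ofReal_re]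
    rw [← Real.rpow_mul (hδ j).le, ← Real.rpow_mul (hδ j).le, ← Real.rpow_add (hδ j)]
    ring_nf
    simp
  have hdet : ∀ X : Matrix ι ι ℂ, (Tᴴ * X * T).det.re = Complex.normSq T.det * X.det.re :=
    fun X => by
    rw [det_mul, det_mul, det_conjTranspose, mul_right_comm, RCLike.star_def,
      ← Complex.normSq_eq_conj_mul_self, Complex.re_ofReal_mul]
  have hA1 := hdet A
  have hB1 := hdet B
  rw [hTA, hre] at hA1
  rw [hTB, hre] at hB1
  rw [hdet] at hTM
  have hA0 : 0 < A.det.re := (Complex.lt_def.1 hA.det_pos).1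
  have hB0 : 0 < B.det.re := (Complex.lt_def.1 hB.det_pos).1
  have hT0 : 0 < Complex.normSq T.det :=
    pos_of_mul_pos_left (hA1 ▸ prod_pos fun j _ => Real.rpow_pos_of_pos (hδ j) _) hA0.le
  have hprod : (Complex.normSq T.det * A.det.re) ^ (1 - l) *
      (Complex.normSq T.det * B.det.re) ^ l = 1 := by
    rw [← hA1, ← hB1, ← Real.finsetProd_rpow _ _ fun j _ => (Real.rpow_pos_of_pos (hδ j) _).le,
      ← Real.finsetProd_rpow _ _ fun j _ => (Real.rpow_pos_of_pos (hδ j) _).le, ← prod_mul_distrib]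
    refine prod_eq_one fun j _ => ?_
    rw [← Real.rpow_mul (hδ j).le, ← Real.rpow_mul (hδ j).le, ← Real.rpow_add (hδ j)]
    ring_nf
    simp
  rw [Real.mul_rpow hT0.le hA0.le, Real.mul_rpow hT0.le hB0.le, mul_mul_mul_comm,
    ← Real.rpow_add hT0, sub_add_cancel, Real.rpow_one] at hprod
  exact le_of_mul_le_mul_left (hTM.trans hprod.ge) hT0

/-- A principal minor of a matrix bounded below by the identity is at most its determinant. -/
lemma det_toBlock_re_le {A : Matrix ι ι ℂ} (hA : (A - 1).PosSemidef) (p : ι → Prop)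
    [DecidablePred p] : (A.toBlock p p).det.re ≤ A.det.re := by
  have hAp : A.PosDef := by simpa using PosDef.one.posSemidef_add hA
  set X := A.toBlock p p with hX
  set Y := A.toBlock p (fun j => ¬ p j) with hY
  set Z := A.toBlock (fun j => ¬ p j) (fun j => ¬ p j) with hZ
  have hXp : X.PosDef := hAp.submatrix Subtype.val_injective
  have hYH : A.toBlock (fun j => ¬ p j) p = Yᴴ := by
    ext i j
    simp [hY, hAp.1.apply]
  let _ : Invertible X := hXp.isUnit.invertible
  have hdet : A.det = X.det * (Z - Yᴴ * ⅟X * Y).det := by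
    rw [det_toBlock A p, hYH, det_fromBlocks₁₁]
  have hpsd : (fromBlocks X Y Yᴴ (Z - 1)).PosSemidef := by
    have h1 := hA.submatrix (Equiv.sumCompl p)
    have h2 : (diagonal (Sum.elim (fun _ : {j // p j} => (1 : ℂ))
      (fun _ : {j // ¬ p j} => (0 : ℂ)))).PosSemidef :=
      PosSemidef.diagonal (by rintro (i | i) <;> simp)
    convert h1.add h2 using 1
    ext (i | i) (j | j)
    · simp [hX, diagonal_apply, one_apply, Subtype.ext_iff]
    · have : (i : ι) ≠ j := fun hij => j.2 (hij ▸ i.2)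
      simp [hY, one_apply, this]
    · have : (i : ι) ≠ j := fun hij => i.2 (hij ▸ j.2)
      simp [← hYH, one_apply, this]
    · simp [hZ, diagonal_apply, one_apply, Subtype.ext_iff]
  have hS : (Z - Yᴴ * ⅟X * Y - 1).PosSemidef := by
    have := (PosDef.fromBlocks₁₁ Y (Z - 1) hXp).1 hpsd
    rw [invOf_eq_nonsing_inv]
    rwa [sub_right_comm]
  have h1 := one_le_det_re hS
  obtain ⟨hx, hx'⟩ := Complex.lt_def.1 hXp.det_pos
  rw [hdet, Complex.mul_re, ← hx']
  simp only [Complex.zero_re, Complex.zero_im] at hx ⊢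
  nlinarith

/-- The analogue of `max (exp s • A) 1`. -/
lemma exists_majorant {A : Matrix ι ι ℂ} (hA : A.PosDef) (s : ℝ) :
    ∃ A' : Matrix ι ι ℂ, (A' - Real.exp s • A).PosSemidef ∧ (A' - 1).PosSemidef ∧
      A'.det.re = Real.exp (∑ j, max (s + Real.log (hA.1.eigenvalues j)) 0) := by
  set U := (hA.1.eigenvectorUnitary : Matrix ι ι ℂ)
  have hU : U * Uᴴ = 1 := Unitary.coe_mul_star_self _
  set α := hA.1.eigenvalues
  have hα : ∀ j, 0 < α j := hA.eigenvalues_pos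
  set D : ι → ℝ := fun j => Real.exp (max (s + Real.log (α j)) 0)
  refine ⟨U * diagonal (fun j => (D j : ℂ)) * Uᴴ, ?_, ?_, ?_⟩
  · have : U * diagonal (fun j => (D j : ℂ)) * Uᴴ - Real.exp s • A =
        U * diagonal (fun j => ((D j - Real.exp s * α j : ℝ) : ℂ)) * Uᴴ := by
      conv_lhs => rw [eq_conj_diagonal hA.1]
      rw [← smul_mul_assoc, ← mul_smul_comm, ← sub_mul, ← mul_sub, ← diagonal_smul,
        diagonal_sub]
      congr 3
      funext j
      simp [α]
    rw [this]
    refine PosSemidef.mul_mul_conjTranspose_same (PosSemidef.diagonal fun j => ?_) U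
    have : Real.exp s * α j ≤ D j := by
      nth_rewrite 1 [← Real.exp_log (hα j)]
      rw [← Real.exp_add]
      exact Real.exp_le_exp.2 (le_max_left _ _)
    exact Complex.zero_le_real.2 (sub_nonneg.2 this)
  · have : U * diagonal (fun j => (D j : ℂ)) * Uᴴ - 1 =
        U * diagonal (fun j => ((D j - 1 : ℝ) : ℂ)) * Uᴴ := by
      rw [← hU]
      conv_lhs => enter [2, 1]; rw [← mul_one U, ← diagonal_one]
      rw [← sub_mul, ← mul_sub, diagonal_sub]
      congr 3
      funext j
      simp
    rw [this]
    refine PosSemidef.mul_mul_conjTranspose_same (PosSemidef.diagonal fun j => ?_) U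
    have : 1 ≤ D j := Real.one_le_exp (le_max_right _ _)
    exact Complex.zero_le_real.2 (sub_nonneg.2 this)
  · rw [det_mul_right_comm, hU, one_mul, det_diagonal, Real.exp_sum]
    exact_mod_cast Complex.ofReal_re _

/-- Weak log-majorization, expressed through the truncated logarithms of the eigenvalues. -/
lemma sum_max_log_eigenvalues_le {A B M : Matrix ι ι ℂ} (hA : A.PosDef) (hB : B.PosDef)
    (hM : M.PosDef) {l : ℝ} (h0 : 0 < l) (h1 : l < 1)
    (h : ∀ x, quad M x ≤ quad A x ^ (1 - l) * quad B x ^ l) (s₁ s₂ : ℝ) :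
    ∑ j, max ((1 - l) * s₁ + l * s₂ + Real.log (hM.1.eigenvalues j)) 0 ≤
      (1 - l) * ∑ j, max (s₁ + Real.log (hA.1.eigenvalues j)) 0 +
        l * ∑ j, max (s₂ + Real.log (hB.1.eigenvalues j)) 0 := by
  obtain ⟨A', hA1, hA2, hA3⟩ := exists_majorant hA s₁
  obtain ⟨B', hB1, hB2, hB3⟩ := exists_majorant hB s₂
  set s := (1 - l) * s₁ + l * s₂ with hs
  set V := (hM.1.eigenvectorUnitary : Matrix ι ι ℂ)
  have hV : Vᴴ * V = 1 := conjTranspose_mul_eigenvectorUnitary hM.1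
  have hVdet : ∀ X : Matrix ι ι ℂ, (Vᴴ * X * V).det = X.det := fun X => by
    rw [det_mul_right_comm, hV, one_mul]
  have hVsub : ∀ X : Matrix ι ι ℂ, (X - 1).PosSemidef → (Vᴴ * X * V - 1).PosSemidef :=
    fun X hX => by
    have := hX.conjTranspose_mul_mul_same V
    rwa [mul_sub, sub_mul, mul_one, hV] at this
  set μ := hM.1.eigenvalues
  have hμ : ∀ j, 0 < μ j := hM.eigenvalues_pos
  classical
  let p : ι → Prop := fun j => 0 < s + Real.log (μ j)
  have hblock : ∀ X : Matrix ι ι ℂ, (X - 1).PosSemidef →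
      ((Vᴴ * X * V).toBlock p p).PosDef ∧ ((Vᴴ * X * V).toBlock p p).det.re ≤ X.det.re :=
    fun X hX => by
    refine ⟨PosDef.submatrix ?_ Subtype.val_injective, ?_⟩
    · simpa using PosDef.one.posSemidef_add (hVsub X hX)
    · rw [← hVdet X]
      exact det_toBlock_re_le (hVsub X hX) p
  obtain ⟨hAp, hAd⟩ := hblock A' hA2
  obtain ⟨hBp, hBd⟩ := hblock B' hB2
  set R : Matrix ι {j // p j} ℂ := V.submatrix id Subtype.val
  have hRX : ∀ X : Matrix ι ι ℂ, (Vᴴ * X * V).toBlock p p = Rᴴ * X * R := fun X => rfl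
  have hMp : ((Vᴴ * (Real.exp s • M) * V).toBlock p p) =
      diagonal (fun j : {j // p j} => ((Real.exp (s + Real.log (μ j)) : ℝ) : ℂ)) := by
    rw [mul_smul_comm, smul_mul_assoc, conjTranspose_mul_mul_eigenvectorUnitary]
    ext i j
    by_cases hij : i = j
    · subst hij
      have hi : Real.exp (s + Real.log (μ i)) = Real.exp s * μ i := by
        rw [Real.exp_add, Real.exp_log (hμ i)]
      simp only [toBlock_apply, Matrix.smul_apply, diagonal_apply_eq, Complex.real_smul, hi,
        Complex.ofReal_mul, μ]
    · have : (i : ι) ≠ j := fun h => hij (Subtype.ext h)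
      simp [toBlock_apply, hij, this]
  have hMps : ((Vᴴ * (Real.exp s • M) * V).toBlock p p).PosSemidef := by
    rw [hMp]
    exact PosSemidef.diagonal fun j => Complex.zero_le_real.2 (Real.exp_pos _).le
  have hmain := det_re_le_of_quad_le hAp hBp hMps (l := l) fun x => by
    rw [hRX, hRX, hRX, quad_conj, quad_conj, quad_conj, quad_smul]
    set y := R *ᵥ x
    have hAq := quad_le_of_sub hA1 y
    have hBq := quad_le_of_sub hB1 y
    rw [quad_smul] at hAq hBq
    have hA0 := quad_nonneg hA.posSemidef y
    have hB0 := quad_nonneg hB.posSemidef y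
    calc Real.exp s * quad M y ≤ Real.exp s * (quad A y ^ (1 - l) * quad B y ^ l) := by
          gcongr; exact h y
      _ = (Real.exp s₁ * quad A y) ^ (1 - l) * (Real.exp s₂ * quad B y) ^ l := by
          rw [Real.mul_rpow (Real.exp_pos _).le hA0, Real.mul_rpow (Real.exp_pos _).le hB0,
            ← Real.exp_mul, ← Real.exp_mul, mul_mul_mul_comm, ← Real.exp_add, hs]
          ring_nf
      _ ≤ _ := by
          have : 0 ≤ 1 - l := by linarith
          have hA' : 0 ≤ quad A' y := le_trans (by positivity) hAq
          gcongr
  have hdetM : ((Vᴴ * (Real.exp s • M) * V).toBlock p p).det.re =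
      Real.exp (∑ j, max (s + Real.log (μ j)) 0) := by
    have hsum : ∑ j, max (s + Real.log (μ j)) 0 = ∑ j : {j // p j}, (s + Real.log (μ j)) := by
      rw [← Fintype.sum_subtype_add_sum_subtype p, sum_congr rfl fun j _ => max_eq_left j.2.le,
        sum_congr rfl fun j _ => max_eq_right (not_lt.1 j.2), sum_const_zero, add_zero]
    rw [hMp, det_diagonal, hsum, Real.exp_sum]
    exact_mod_cast Complex.ofReal_re _
  have hAd0 : 0 < ((Vᴴ * A' * V).toBlock p p).det.re := (Complex.lt_def.1 hAp.det_pos).1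
  have hBd0 : 0 < ((Vᴴ * B' * V).toBlock p p).det.re := (Complex.lt_def.1 hBp.det_pos).1
  have hfin : ((Vᴴ * (Real.exp s • M) * V).toBlock p p).det.re ≤
      A'.det.re ^ (1 - l) * B'.det.re ^ l := by
    refine hmain.trans ?_
    have : 0 ≤ 1 - l := by linarith
    have hA' : 0 ≤ A'.det.re := hAd0.le.trans hAd
    gcongr
  rw [hdetM, hA3, hB3, ← Real.exp_mul, ← Real.exp_mul, ← Real.exp_add, Real.exp_le_exp] at hfin
  linarith

lemma integral_max_mul_exp {t k : ℝ} (ht : 0 < t) (hk : 0 < k) (ν : ℝ) :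
    Integrable (fun s : ℝ => max (k * s + ν) 0 * Real.exp (-(t * s))) ∧
      ∫ s : ℝ, max (k * s + ν) 0 * Real.exp (-(t * s)) = k * Real.exp (t * ν / k) / t ^ 2 := by
  set F : ℝ → ℝ := fun s => max s 0 * Real.exp (-(t * s)) with hF
  have hFi : F = Set.indicator (Set.Ioi 0) (fun s => s * Real.exp (-(t * s))) := by
    funext s
    by_cases hs : 0 < s
    · simp [hF, hs, hs.le]
    · simp [hF, hs, not_lt.1 hs]
  have hG := Real.integral_rpow_mul_exp_neg_mul_Ioi (a := 2) (r := t) two_pos ht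
  have hI : IntegrableOn (fun s : ℝ => s * Real.exp (-(t * s))) (Set.Ioi 0) := by
    have := integrableOn_rpow_mul_exp_neg_mul_rpow (s := 1) (p := 1) (b := t)
      (by norm_num) one_pos ht
    simpa using this
  have hFint : Integrable F := by
    rw [hFi, integrable_indicator_iff measurableSet_Ioi]
    exact hI
  have hFval : ∫ s, F s = 1 / t ^ 2 := by
    rw [hFi, integral_indicator measurableSet_Ioi]
    norm_num [Real.Gamma_two] at hG
    simpa using hG
  have hfun : (fun s : ℝ => max (k * s + ν) 0 * Real.exp (-(t * s))) =
      fun s => k * Real.exp (t * ν / k) * F (s + ν / k) := by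
    funext s
    have h1 : max (k * s + ν) 0 = k * max (s + ν / k) 0 := by
      rw [mul_max_of_nonneg _ _ hk.le, mul_zero]
      congr 1
      field_simp
    have h2 : Real.exp (-(t * s)) = Real.exp (t * ν / k) * Real.exp (-(t * (s + ν / k))) := by
      rw [← Real.exp_add]
      ring_nf
    simp only [hF]
    rw [h1, h2]
    ring
  rw [hfun]
  refine ⟨(hFint.comp_add_right (ν / k)).const_mul _, ?_⟩
  rw [integral_const_mul, integral_add_right_eq_self F, hFval]
  ring

/-- Log-convexity of the power traces under interpolation of quadratic forms. -/
lemma sum_eigenvalues_rpow_le [Nonempty ι] {A B M : Matrix ι ι ℂ} (hA : A.PosDef) (hB : B.PosDef)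
    (hM : M.PosDef) {a b t θ₁ θ₂ : ℝ} (ha : 0 < a) (hb : 0 < b) (h₁ : 0 < θ₁) (h₂ : 0 < θ₂)
    (hθ : θ₁ + θ₂ = 1) (ht : t = θ₁ * a + θ₂ * b)
    (h : ∀ x, quad M x ≤ quad A x ^ (1 - θ₂ * b / t) * quad B x ^ (θ₂ * b / t)) :
    Real.log (∑ j, hM.1.eigenvalues j ^ t) ≤
      θ₁ * Real.log (∑ j, hA.1.eigenvalues j ^ a) +
        θ₂ * Real.log (∑ j, hB.1.eigenvalues j ^ b) := by
  have ht0 : 0 < t := by rw [ht]; positivity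
  set l := θ₂ * b / t with hl
  have hl1 : 1 - l = θ₁ * a / t := by
    rw [hl]
    field_simp
    linarith
  have hl0 : 0 < l := by positivity
  have hl1' : l < 1 := by
    have : 0 < 1 - l := by rw [hl1]; positivity
    linarith
  have hpos : ∀ {X : Matrix ι ι ℂ} (hX : X.PosDef) (r : ℝ), 0 < ∑ j, hX.1.eigenvalues j ^ r :=
    fun hX r => sum_pos (fun j _ => Real.rpow_pos_of_pos (hX.eigenvalues_pos j) r) univ_nonempty
  set FA := ∑ j, hA.1.eigenvalues j ^ a with hFA
  set FB := ∑ j, hB.1.eigenvalues j ^ b with hFB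
  have hFA0 : 0 < FA := hpos hA a
  have hFB0 : 0 < FB := hpos hB b
  set G := θ₁ * Real.log FA + θ₂ * Real.log FB with hG
  set c₁ := (G - Real.log FA) / a with hc₁
  set c₂ := (G - Real.log FB) / b with hc₂
  have hpt : ∀ s : ℝ, ∑ j, max (1 * s + Real.log (hM.1.eigenvalues j)) 0 * Real.exp (-(t * s)) ≤
      (1 - l) * ∑ j, max (t / a * s + (c₁ + Real.log (hA.1.eigenvalues j))) 0 *
        Real.exp (-(t * s)) +
      l * ∑ j, max (t / b * s + (c₂ + Real.log (hB.1.eigenvalues j))) 0 *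
        Real.exp (-(t * s)) := fun s => by
    have hs := sum_max_log_eigenvalues_le hA hB hM hl0 hl1' h (t / a * s + c₁) (t / b * s + c₂)
    have hcomb : (1 - l) * (t / a * s + c₁) + l * (t / b * s + c₂) = 1 * s := by
      have hθ' : θ₁ = 1 - θ₂ := by linarith
      rw [hl1, hl, hc₁, hc₂, hG]
      field_simp
      rw [hθ']
      ring
    rw [hcomb] at hs
    simp only [← sum_mul, ← mul_assoc, ← add_mul]
    refine mul_le_mul_of_nonneg_right ?_ (Real.exp_pos _).le
    simpa only [add_assoc] using hs
  have hintM := fun j => integral_max_mul_exp ht0 one_pos (Real.log (hM.1.eigenvalues j))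
  have hintA := fun j => integral_max_mul_exp ht0 (div_pos ht0 ha)
    (c₁ + Real.log (hA.1.eigenvalues j))
  have hintB := fun j => integral_max_mul_exp ht0 (div_pos ht0 hb)
    (c₂ + Real.log (hB.1.eigenvalues j))
  have hIA := (integrable_finsetSum univ fun j _ => (hintA j).1).const_mul (1 - l)
  have hIB := (integrable_finsetSum univ fun j _ => (hintB j).1).const_mul l
  have hmono := integral_mono (integrable_finsetSum univ fun j _ => (hintM j).1)
    (hIA.add hIB) hpt
  simp only [Pi.add_apply] at hmono
  rw [integral_add hIA hIB, integral_const_mul, integral_const_mul,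
    integral_finsetSum _ fun j _ => (hintM j).1, integral_finsetSum _ fun j _ => (hintA j).1,
    integral_finsetSum _ fun j _ => (hintB j).1, sum_congr rfl fun j _ => (hintM j).2,
    sum_congr rfl fun j _ => (hintA j).2, sum_congr rfl fun j _ => (hintB j).2] at hmono
  have hexp : ∀ {X : Matrix ι ι ℂ} (hX : X.PosDef) {r : ℝ}, 0 < r → ∀ j,
      t / r * Real.exp (t * ((G - Real.log (∑ j, hX.1.eigenvalues j ^ r)) / r +
        Real.log (hX.1.eigenvalues j)) / (t / r)) / t ^ 2 =
      Real.exp G / (∑ j, hX.1.eigenvalues j ^ r) / (r * t) * hX.1.eigenvalues j ^ r :=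
    fun hX r hr j => by
    have : t * ((G - Real.log (∑ j, hX.1.eigenvalues j ^ r)) / r +
        Real.log (hX.1.eigenvalues j)) / (t / r) =
        G - Real.log (∑ j, hX.1.eigenvalues j ^ r) + Real.log (hX.1.eigenvalues j) * r := by
      field_simp
    rw [this, Real.exp_add, Real.exp_sub, Real.exp_log (hpos hX r),
      ← Real.rpow_def_of_pos (hX.eigenvalues_pos j)]
    field_simp
  rw [sum_congr rfl fun j _ => hexp hA ha j, sum_congr rfl fun j _ => hexp hB hb j, ← mul_sum,
    ← mul_sum, ← hFA, ← hFB, hl1, hl] at hmono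
  have hMs : ∀ j, 1 * Real.exp (t * Real.log (hM.1.eigenvalues j) / 1) / t ^ 2 =
      hM.1.eigenvalues j ^ t / t ^ 2 := fun j => by
    rw [Real.rpow_def_of_pos (hM.eigenvalues_pos j), one_mul, div_one, mul_comm t]
  rw [sum_congr rfl fun j _ => hMs j, ← sum_div] at hmono
  have hR : θ₁ * a / t * (Real.exp G / FA / (a * t) * FA) +
      θ₂ * b / t * (Real.exp G / FB / (b * t) * FB) = Real.exp G / t ^ 2 := by
    have hθ' : θ₁ = 1 - θ₂ := by linarith
    field_simp
    rw [hθ']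
    ring
  rw [hR, div_le_div_iff_of_pos_right (by positivity)] at hmono
  exact (Real.log_le_iff_le_exp (hpos hM t)).2 hmono

end

lemma posDef_sum_mpow {d n : ℕ} (W : Fin n → Matrix (Fin d) (Fin d) ℂ)
    (hW : ∀ i, (W i).PosDef) (P : Fin n → ℝ) (hP : ∀ i, 0 ≤ P i) (hP1 : ∑ i, P i = 1) (r : ℝ) :
    (∑ i, P i • mpow (W i) r).PosDef := by
  obtain ⟨i, -, hi⟩ : ∃ i ∈ univ, 0 < P i := exists_lt_of_sum_lt (by simp [hP1])
  rw [← add_sum_erase univ _ (mem_univ i)]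
  exact ((posDef_mpow (hW i) r).smul hi).add_posSemidef
    (posSemidef_sum _ fun j _ => (posDef_mpow (hW j) r).posSemidef.smul (hP j))

end PetzRenyi

/-- concavity of the Petz Rényi auxiliary function
`E₀^{(1)}(s,P) = -log Tr[(Σ_i P(i)·W_i^{1/(1+s)})^{1+s}]` on `(-1,0)`. -/
theorem petz_renyi_auxiliary_concave {d n : ℕ} (hd : 0 < d) (hn : 0 < n)
    (W : Fin n → Matrix (Fin d) (Fin d) ℂ)
    (hW : ∀ i, (W i).PosDef ∧ (W i).trace = 1)
    (P : Fin n → ℝ) (hP : ∀ i, 0 ≤ P i) (hP1 : ∑ i, P i = 1) :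
    ConcaveOn ℝ (Set.Ioo (-1 : ℝ) 0)
      (fun s => -Real.log (trR (mpow (∑ i, P i • mpow (W i) (1 / (1 + s))) (1 + s)))) := by
  have : Nonempty (Fin d) := ⟨⟨0, hd⟩⟩
  have hpd := PetzRenyi.posDef_sum_mpow W (fun i => (hW i).1) P hP hP1
  refine ConvexOn.neg (convexOn_iff_forall_pos.2 ⟨convex_Ioo _ _, ?_⟩)
  intro x hx y hy a b ha hb hab
  have hx0 : 0 < 1 + x := by linarith [hx.1]
  have hy0 : 0 < 1 + y := by linarith [hy.1]
  have ht : 1 + (a • x + b • y) = a * (1 + x) + b * (1 + y) := by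
    simp only [smul_eq_mul]
    linarith
  have ht0 : 0 < 1 + (a • x + b • y) := by
    rw [ht]
    positivity
  simp only [PetzRenyi.trR_mpow (hpd _).1]
  refine PetzRenyi.sum_eigenvalues_rpow_le (hpd _) (hpd _) (hpd _) hx0 hy0 ha hb hab ht
    fun v => ?_
  set t := 1 + (a • x + b • y)
  have hl : 1 - b * (1 + y) / t = a * (1 + x) / t := by
    field_simp
    linarith
  have hl1 : 0 < 1 - b * (1 + y) / t := by
    rw [hl]
    positivity
  have hu : 1 / t = (1 - b * (1 + y) / t) * (1 / (1 + x)) + b * (1 + y) / t * (1 / (1 + y)) := by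
    rw [hl]
    field_simp
    linarith
  have := PetzRenyi.quad_sum_mpow_le W (fun i => (hW i).1) P hP
    (l := b * (1 + y) / t) (by positivity) (by linarith) (1 / (1 + x)) (1 / (1 + y)) v
  rwa [← hu] at this
end

section
/- (Tensor-power interpolation inequality, Petz version.) Let m ≥ 1 and let ρ be a positive semidefinite d^m×d^m complex matrix, viewed as an operator on the m-fold tensor power (ℂ^d)^{⊗m}. For α ∈ (1,∞) define F(α) := inf over positive definite d×d density matrices σ of (Tr[ρ^α·(σ^{⊗m})^{1−α}])^{1/α}. Then for all α_0, α_1 ∈ (1,∞), θ ∈ [0,1], and α defined by 1/α = (1−θ)/α_0 + θ/α_1, one has F(α) ≤ F(α_0)^{1−θ}·F(α_1)^{θ}. -/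
open Matrix
open scoped ComplexOrder

/-- `m`-fold tensor (Kronecker) power of a `d × d` matrix, as a matrix indexed by
`Fin m → Fin d` (i.e., an operator on `(ℂ^d)^{⊗m}`). -/
noncomputable def tensPow {d : ℕ} (σ : Matrix (Fin d) (Fin d) ℂ) (m : ℕ) :
    Matrix (Fin m → Fin d) (Fin m → Fin d) ℂ :=
  fun x y => ∏ j, σ (x j) (y j)


/-- The complex diagonal matrix with given real entries. -/
noncomputable def realDiag {ι : Type*} [DecidableEq ι] (a : ι → ℝ) : Matrix ι ι ℂ :=
  diagonal fun i => (a i : ℂ)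

section Diagonalization

variable {ι : Type*} [DecidableEq ι]

lemma realDiag_one : realDiag (fun _ : ι => (1 : ℝ)) = 1 := by
  simp [realDiag]

lemma realDiag_conjTranspose (a : ι → ℝ) : (realDiag a)ᴴ = realDiag a := by
  simp [realDiag, diagonal_conjTranspose]

lemma smul_realDiag (c : ℝ) (a : ι → ℝ) : c • realDiag a = realDiag fun i => c * a i := by
  ext i j
  by_cases h : i = j <;> simp [realDiag, h, Matrix.diagonal]

lemma realDiag_add (a b : ι → ℝ) :
    realDiag a + realDiag b = realDiag fun i => a i + b i := by
  simp [realDiag]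

lemma realDiag_sub (a b : ι → ℝ) :
    realDiag a - realDiag b = realDiag fun i => a i - b i := by
  simp [realDiag]

lemma realDiag_posSemidef {a : ι → ℝ} (ha : ∀ i, 0 ≤ a i) : (realDiag a).PosSemidef :=
  PosSemidef.diagonal fun i => by simpa using ha i

lemma realDiag_posDef {a : ι → ℝ} (ha : ∀ i, 0 < a i) : (realDiag a).PosDef :=
  PosDef.diagonal fun i => by simpa using ha i

variable [Fintype ι]

lemma realDiag_mul (a b : ι → ℝ) :
    realDiag a * realDiag b = realDiag fun i => a i * b i := by
  simp [realDiag]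

lemma norm_det_realDiag {a : ι → ℝ} (ha : ∀ i, 0 ≤ a i) : ‖(realDiag a).det‖ = ∏ i, a i := by
  rw [realDiag, det_diagonal, norm_prod]
  exact Finset.prod_congr rfl fun i _ => by simp [abs_of_nonneg (ha i)]

lemma Matrix.IsHermitian.exists_unitary_realDiag {A : Matrix ι ι ℂ} (hA : A.IsHermitian) :
    ∃ U : Matrix ι ι ℂ, U * Uᴴ = 1 ∧ Uᴴ * U = 1 ∧ A = U * realDiag hA.eigenvalues * Uᴴ := by
  refine ⟨hA.eigenvectorUnitary, Unitary.coe_mul_star_self _, Unitary.coe_star_mul_self _, ?_⟩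
  conv_lhs => rw [hA.spectral_theorem]
  rfl

lemma Matrix.PosDef.exists_unitary_realDiag {A : Matrix ι ι ℂ} (hA : A.PosDef) :
    ∃ (U : Matrix ι ι ℂ) (a : ι → ℝ), U * Uᴴ = 1 ∧ Uᴴ * U = 1 ∧ (∀ i, 0 < a i) ∧
      A = U * realDiag a * Uᴴ := by
  obtain ⟨U, h1, h2, h3⟩ := hA.1.exists_unitary_realDiag
  exact ⟨U, _, h1, h2, hA.eigenvalues_pos, h3⟩

lemma Matrix.PosSemidef.exists_unitary_realDiag {A : Matrix ι ι ℂ} (hA : A.PosSemidef) :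
    ∃ (U : Matrix ι ι ℂ) (a : ι → ℝ), U * Uᴴ = 1 ∧ Uᴴ * U = 1 ∧ (∀ i, 0 ≤ a i) ∧
      A = U * realDiag a * Uᴴ := by
  obtain ⟨U, h1, h2, h3⟩ := hA.1.exists_unitary_realDiag
  exact ⟨U, _, h1, h2, hA.eigenvalues_nonneg, h3⟩

lemma Matrix.PosDef.conj_of_isUnit_det {A S : Matrix ι ι ℂ} (hA : A.PosDef) (hS : IsUnit S.det) :
    (S * A * Sᴴ).PosDef :=
  (IsUnit.posDef_star_right_conjugate_iff ((isUnit_iff_isUnit_det S).2 hS)).2 hA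

lemma isUnit_det_of_posDef_mul_conjTranspose {S : Matrix ι ι ℂ} (h : (S * Sᴴ).PosDef) :
    IsUnit S.det := by
  have := (isUnit_iff_isUnit_det _).1 h.isUnit
  rw [det_mul] at this
  exact isUnit_of_mul_isUnit_left this

lemma inv_conj_conj {S A : Matrix ι ι ℂ} (hS : IsUnit S.det) :
    S * (S⁻¹ * A * S⁻¹ᴴ) * Sᴴ = A := by
  have h1 : S⁻¹ᴴ * Sᴴ = 1 := by rw [← conjTranspose_mul, mul_nonsing_inv _ hS, conjTranspose_one]
  calc _ = (S * S⁻¹) * A * (S⁻¹ᴴ * Sᴴ) := by simp only [Matrix.mul_assoc]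
    _ = A := by rw [h1, mul_nonsing_inv _ hS, Matrix.one_mul, Matrix.mul_one]

/-- Simultaneous diagonalization of two positive definite matrices by a congruence. -/
lemma Matrix.PosDef.exists_simultaneous_congruence {P Q : Matrix ι ι ℂ} (hP : P.PosDef)
    (hQ : Q.PosDef) :
    ∃ (S : Matrix ι ι ℂ) (l : ι → ℝ), IsUnit S.det ∧ (∀ i, 0 < l i) ∧ P = S * Sᴴ ∧
      Q = S * realDiag l * Sᴴ := by
  obtain ⟨U, a, -, -, ha, hPU⟩ := hP.exists_unitary_realDiag
  set R := U * realDiag (fun i => √(a i)) with hR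
  have hPR : P = R * Rᴴ := by
    rw [hPU, hR, conjTranspose_mul, realDiag_conjTranspose, Matrix.mul_assoc, Matrix.mul_assoc,
      ← Matrix.mul_assoc (realDiag _) (realDiag _), realDiag_mul]
    simp only [Real.mul_self_sqrt (ha _).le]
  have hRu : IsUnit R.det := isUnit_det_of_posDef_mul_conjTranspose (hPR ▸ hP)
  have hRi : IsUnit R⁻¹.det := isUnit_nonsing_inv_det _ hRu
  obtain ⟨V, l, hV, -, hl, hQV⟩ := (hQ.conj_of_isUnit_det hRi).exists_unitary_realDiag
  have hP' : P = R * V * (R * V)ᴴ := by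
    rw [conjTranspose_mul, Matrix.mul_assoc, ← Matrix.mul_assoc V, hV, Matrix.one_mul, hPR]
  refine ⟨R * V, l, isUnit_det_of_posDef_mul_conjTranspose (hP' ▸ hP), hl, hP', ?_⟩
  rw [← inv_conj_conj (A := Q) hRu, hQV, conjTranspose_mul R V]
  simp only [Matrix.mul_assoc]

lemma conj_realDiag_apply_self {κ : Type*} (Y : Matrix κ ι ℂ) (l : ι → ℝ) (j : κ) :
    (Y * realDiag l * Yᴴ) j j = ((∑ x, ‖Y j x‖ ^ 2 * l x : ℝ) : ℂ) := by
  rw [realDiag, mul_apply]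
  push_cast
  refine Finset.sum_congr rfl fun x _ => ?_
  rw [mul_diagonal, conjTranspose_apply, mul_right_comm, ← Complex.mul_conj']
  rfl

lemma mpow_conj_realDiag {U : Matrix ι ι ℂ} (h1 : U * Uᴴ = 1) (h2 : Uᴴ * U = 1) (a : ι → ℝ)
    (r : ℝ) : mpow (U * realDiag a * Uᴴ) r = U * realDiag (fun i => a i ^ r) * Uᴴ := by
  set A := U * realDiag a * Uᴴ with hA
  have hAh : A.IsHermitian := by
    rw [IsHermitian, hA]
    simp [realDiag_conjTranspose, Matrix.mul_assoc]
  have hfin : (spectrum ℝ A ∪ Set.range a).Finite :=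
    (finite_real_spectrum (A := A)).union (Set.finite_range a)
  set T := hfin.toFinset
  set p := Lagrange.interpolate T id (fun x => x ^ r) with hp
  have hpe : ∀ x ∈ spectrum ℝ A ∪ Set.range a, p.eval x = x ^ r := fun x hx =>
    Lagrange.eval_interpolate_at_node (v := id) _ (Set.injOn_id _) (hfin.mem_toFinset.2 hx)
  have key : ∀ q : Polynomial ℝ,
      Polynomial.aeval A q = U * realDiag (fun i => q.eval (a i)) * Uᴴ := by
    intro q
    induction q using Polynomial.induction_on' with
    | add p q hp hq =>
      rw [map_add, hp, hq, ← Matrix.add_mul, ← Matrix.mul_add]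
      simp only [realDiag_add, Polynomial.eval_add]
    | monomial n c =>
      rw [Polynomial.aeval_monomial]
      have hpow : A ^ n = U * realDiag (fun i => a i ^ n) * Uᴴ := by
        induction n with
        | zero => simp [realDiag_one, h1]
        | succ n ih =>
          rw [pow_succ, ih, hA]
          calc _ = U * (realDiag (fun i => a i ^ n) * (Uᴴ * U) * realDiag a) * Uᴴ := by
                simp only [Matrix.mul_assoc]
            _ = _ := by rw [h2, Matrix.mul_one, realDiag_mul]; simp only [pow_succ]
      rw [hpow, ← Algebra.smul_def, ← Matrix.smul_mul, ← Matrix.mul_smul, smul_realDiag]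
      simp only [Polynomial.eval_monomial]
  rw [mpow, cfc_congr (g := fun x => p.eval x) (fun x hx => (hpe x (Or.inl hx)).symm),
    cfc_polynomial p A hAh.isSelfAdjoint, key]
  congr 3
  funext i
  exact hpe _ (Or.inr ⟨i, rfl⟩)

end Diagonalization

section DeterminantInequalities

variable {ι κ : Type*} [Fintype ι] [DecidableEq ι] [Fintype κ] [DecidableEq κ]

lemma sum_rpow_mul_rpow_le {α : Type*} (s : Finset α) {x y : α → ℝ} (hx : ∀ i, 0 ≤ x i)
    (hy : ∀ i, 0 ≤ y i) {t : ℝ} (ht : t ∈ Set.Icc (0 : ℝ) 1) :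
    ∑ i ∈ s, x i ^ (1 - t) * y i ^ t ≤ (∑ i ∈ s, x i) ^ (1 - t) * (∑ i ∈ s, y i) ^ t := by
  rcases ht.1.eq_or_lt with rfl | h0
  · simp
  rcases ht.2.eq_or_lt with rfl | h1
  · simp
  have h1' : 0 < 1 - t := by linarith
  have hpq : (1 - t)⁻¹.HolderConjugate t⁻¹ := by
    rw [Real.holderConjugate_iff]
    exact ⟨(one_lt_inv₀ h1').2 (by linarith), by simp⟩
  have := Real.inner_le_Lp_mul_Lq_of_nonneg s hpq (f := fun i => x i ^ (1 - t))
    (g := fun i => y i ^ t) (fun i _ => Real.rpow_nonneg (hx i) _)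
    (fun i _ => Real.rpow_nonneg (hy i) _)
  simpa [← Real.rpow_mul (hx _), ← Real.rpow_mul (hy _), h0.ne', h1'.ne'] using this

lemma sum_mul_rpow_le {α : Type*} (s : Finset α) {w l : α → ℝ} (hw : ∀ i, 0 ≤ w i)
    (hl : ∀ i, 0 ≤ l i) {t : ℝ} (ht : t ∈ Set.Icc (0 : ℝ) 1) :
    ∑ i ∈ s, w i * l i ^ t ≤ (∑ i ∈ s, w i) ^ (1 - t) * (∑ i ∈ s, w i * l i) ^ t := by
  refine le_trans (le_of_eq ?_)
    (sum_rpow_mul_rpow_le s hw (fun i => mul_nonneg (hw i) (hl i)) ht)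
  refine Finset.sum_congr rfl fun i _ => ?_
  rw [Real.mul_rpow (hw i) (hl i), ← mul_assoc,
    ← Real.rpow_add_of_nonneg (hw i) (by linarith [ht.2]) ht.1]
  simp

lemma Matrix.PosSemidef.norm_det_le_one {N : Matrix κ κ ℂ} (hN : N.PosSemidef)
    (h : N.trace.re ≤ Fintype.card κ) : ‖N.det‖ ≤ 1 := by
  have hev := hN.eigenvalues_nonneg
  rw [hN.1.trace_eq_sum_eigenvalues] at h
  rw [hN.1.det_eq_prod_eigenvalues, norm_prod]
  have h' : ∑ i, hN.1.eigenvalues i ≤ Fintype.card κ := by simpa using h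
  calc ∏ i, ‖((hN.1.eigenvalues i : ℝ) : ℂ)‖ = ∏ i, hN.1.eigenvalues i :=
        Finset.prod_congr rfl fun i _ => by simp [abs_of_nonneg (hev i)]
    _ ≤ ∏ i, Real.exp (hN.1.eigenvalues i - 1) :=
        Finset.prod_le_prod (fun i _ => hev i) fun i _ => by
          linarith [Real.add_one_le_exp (hN.1.eigenvalues i - 1)]
    _ ≤ 1 := by
        rw [← Real.exp_sum, Real.exp_le_one_iff]
        simpa using h'

/-- Hadamard's determinant inequality. -/
lemma Matrix.PosSemidef.norm_det_le_prod {N : Matrix κ κ ℂ} (hN : N.PosSemidef) {c : κ → ℝ}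
    (hc : ∀ j, 0 < c j) (h : ∀ j, (N j j).re ≤ c j) : ‖N.det‖ ≤ ∏ j, c j := by
  set s : κ → ℝ := fun j => (√(c j))⁻¹ with hs
  have hs0 : ∀ j, 0 ≤ s j := fun j => by positivity
  have hsc : ∀ j, s j * s j = (c j)⁻¹ := fun j => by
    rw [hs]; simp only [← mul_inv, Real.mul_self_sqrt (hc j).le]
  have hN' := hN.mul_mul_conjTranspose_same (realDiag s)
  rw [realDiag_conjTranspose] at hN'
  have h1 := hN'.norm_det_le_one (by
    rw [trace, Complex.re_sum, Fintype.card, Finset.cast_card]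
    refine Finset.sum_le_sum fun j _ => ?_
    have : (realDiag s * N * realDiag s).diag j = ((s j * s j : ℝ) : ℂ) * N j j := by
      simp [realDiag]; ring
    rw [this, Complex.re_ofReal_mul, hsc, inv_mul_le_iff₀ (hc j), mul_one]
    exact h j)
  have hprod : (∏ j, s j) * (∏ j, s j) = (∏ j, c j)⁻¹ := by
    rw [← Finset.prod_mul_distrib, ← Finset.prod_inv_distrib]
    exact Finset.prod_congr rfl fun j _ => hsc j
  rw [det_mul, det_mul, norm_mul, norm_mul, norm_det_realDiag hs0, mul_right_comm, hprod,
    inv_mul_le_iff₀ (Finset.prod_pos fun j _ => hc j), mul_one] at h1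
  exact h1

lemma Matrix.PosSemidef.norm_det_mono {P Q : Matrix κ κ ℂ} (hP : P.PosSemidef) (hQ : Q.PosDef)
    (h : (Q - P).PosSemidef) : ‖P.det‖ ≤ ‖Q.det‖ := by
  obtain ⟨R, -, hR, -, hQR, -⟩ := hQ.exists_simultaneous_congruence hQ
  have hP' := hP.mul_mul_conjTranspose_same R⁻¹
  have hone : R⁻¹ * Q * R⁻¹ᴴ = 1 := by
    rw [hQR, ← Matrix.mul_assoc, nonsing_inv_mul _ hR, Matrix.one_mul, ← conjTranspose_mul,
      nonsing_inv_mul _ hR, conjTranspose_one]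
  have hd := h.mul_mul_conjTranspose_same R⁻¹
  rw [Matrix.mul_sub, Matrix.sub_mul, hone] at hd
  have hle := hP'.norm_det_le_prod (c := fun _ => 1) (fun _ => one_pos) (fun j => by
    have := (Complex.le_def.1 (hd.diag_nonneg (i := j))).1
    simpa using this)
  rw [Finset.prod_const_one] at hle
  rw [← inv_conj_conj (A := P) hR, hQR]
  generalize R⁻¹ * P * R⁻¹ᴴ = N at hle
  rw [det_mul, det_mul, det_mul, norm_mul, norm_mul, norm_mul]
  gcongr
  exact mul_le_of_le_one_right (norm_nonneg _) hle

/-- Log-convexity of the determinant along the geodesic `t ↦ W diag(l ^ t) Wᴴ`. -/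
lemma norm_det_conj_rpow_le (W : Matrix κ ι ℂ) {l : ι → ℝ} (hl : ∀ i, 0 < l i)
    (hP : (W * Wᴴ).PosDef) (hQ : (W * realDiag l * Wᴴ).PosDef) {t : ℝ}
    (ht : t ∈ Set.Icc (0 : ℝ) 1) :
    ‖(W * realDiag (fun i => l i ^ t) * Wᴴ).det‖ ≤
      ‖(W * Wᴴ).det‖ ^ (1 - t) * ‖(W * realDiag l * Wᴴ).det‖ ^ t := by
  obtain ⟨R, M, hR, hM, hPR, hQR⟩ := hP.exists_simultaneous_congruence hQ
  set Y := R⁻¹ * W with hY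
  have hW : W = R * Y := by rw [hY, ← Matrix.mul_assoc, mul_nonsing_inv _ hR, Matrix.one_mul]
  have hWD : ∀ D : Matrix ι ι ℂ, W * D * Wᴴ = R * (Y * D * Yᴴ) * Rᴴ := fun D => by
    rw [hW, conjTranspose_mul]; simp only [Matrix.mul_assoc]
  have hcancel : ∀ X Z : Matrix κ κ ℂ, R * X * Rᴴ = R * Z * Rᴴ → X = Z := fun X Z h => by
    have hR' : IsUnit Rᴴ.det := by rw [det_conjTranspose]; exact hR.star
    have h1 := congrArg (fun B => R⁻¹ * (B * Rᴴ⁻¹)) h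
    simpa only [Matrix.mul_assoc, mul_nonsing_inv _ hR', Matrix.mul_one,
      nonsing_inv_mul_cancel_left _ _ hR] using h1
  have hY1 : Y * realDiag (fun _ : ι => (1 : ℝ)) * Yᴴ = 1 := hcancel _ 1 (by
    rw [← hWD, realDiag_one, Matrix.mul_one, Matrix.mul_one, hPR])
  have hYM : Y * realDiag l * Yᴴ = realDiag M := hcancel _ (realDiag M) (by rw [← hWD, hQR])
  have hrow1 : ∀ j, ∑ x, ‖Y j x‖ ^ 2 = 1 := fun j => by
    have := congrFun (congrFun hY1 j) j
    rw [conj_realDiag_apply_self, one_apply_eq] at this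
    simp only [mul_one] at this
    exact_mod_cast this
  have hrowM : ∀ j, ∑ x, ‖Y j x‖ ^ 2 * l x = M j := fun j => by
    have := congrFun (congrFun hYM j) j
    rw [conj_realDiag_apply_self, realDiag, diagonal_apply_eq] at this
    exact Complex.ofReal_injective this
  have hN : (Y * realDiag (fun i => l i ^ t) * Yᴴ).PosSemidef :=
    (realDiag_posSemidef fun i => Real.rpow_nonneg (hl i).le _).mul_mul_conjTranspose_same Y
  have hdet := hN.norm_det_le_prod (c := fun j => M j ^ t) (fun j => Real.rpow_pos_of_pos (hM j) _)
    (fun j => by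
      rw [conj_realDiag_apply_self, Complex.ofReal_re]
      refine (sum_mul_rpow_le _ (fun x => by positivity) (fun x => (hl x).le) ht).trans ?_
      rw [hrow1, hrowM, Real.one_rpow, one_mul])
  rw [hWD, hPR, hQR]
  simp only [det_mul, norm_mul, det_conjTranspose, norm_star,
    norm_det_realDiag (fun j => (hM j).le)]
  have h0 : 0 < ‖R.det‖ := norm_pos_iff.2 hR.ne_zero
  have h1 : 0 < ∏ j, M j := Finset.prod_pos fun j _ => hM j
  rw [Real.finsetProd_rpow _ _ fun j _ => (hM j).le] at hdet
  have hsplit : (‖R.det‖ * ‖R.det‖) ^ (1 - t) * (‖R.det‖ * (∏ j, M j) * ‖R.det‖) ^ t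
      = ‖R.det‖ * (∏ j, M j) ^ t * ‖R.det‖ := by
    rw [mul_right_comm ‖R.det‖ (∏ j, M j), Real.mul_rpow (by positivity) h1.le, ← mul_assoc,
      ← Real.rpow_add (by positivity)]
    simp
    ring
  rw [hsplit]
  gcongr

/-- The determinant of a compression is bounded by the product of the eigenvalues above one. -/
lemma norm_det_compression_le {W : Matrix κ ι ℂ} (hW : W * Wᴴ = 1) {a : ι → ℝ}
    (ha : ∀ i, 0 ≤ a i) : ‖(W * realDiag a * Wᴴ).det‖ ≤ ∏ i, max 1 (a i) := by
  set y : ι → ℝ := fun i => max 1 (a i) - 1 with hy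
  have hy0 : ∀ i, 0 ≤ y i := fun i => sub_nonneg.2 (le_max_left _ _)
  set r := realDiag fun i => √(y i) with hr
  have hrr : r * r = realDiag y := by
    rw [hr, realDiag_mul]; simp only [Real.mul_self_sqrt (hy0 _)]
  have hrH : rᴴ = r := realDiag_conjTranspose _
  have h1 : ‖(W * realDiag a * Wᴴ).det‖ ≤ ‖(1 + W * realDiag y * Wᴴ).det‖ := by
    refine ((realDiag_posSemidef ha).mul_mul_conjTranspose_same W).norm_det_mono
      (PosDef.one.add_posSemidef ((realDiag_posSemidef hy0).mul_mul_conjTranspose_same W)) ?_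
    have : 1 + W * realDiag y * Wᴴ - W * realDiag a * Wᴴ =
        W * realDiag (fun i => 1 + y i - a i) * Wᴴ := by
      rw [← realDiag_sub (fun i => 1 + y i) a, ← realDiag_add (fun _ => 1) y, realDiag_one, Matrix.mul_sub, Matrix.sub_mul,
        Matrix.mul_add, Matrix.add_mul, Matrix.mul_one, hW]
    rw [this]
    refine (realDiag_posSemidef fun i => ?_).mul_mul_conjTranspose_same W
    simp [hy]
  have h2 : (1 + W * realDiag y * Wᴴ).det = (1 + r * (Wᴴ * W) * r).det := by
    rw [← hrr]
    calc _ = (1 + (W * r) * (r * Wᴴ)).det := by simp only [Matrix.mul_assoc]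
      _ = _ := by rw [det_one_add_mul_comm]; simp only [Matrix.mul_assoc]
  have h3 : ‖(1 + r * (Wᴴ * W) * r).det‖ ≤ ‖(1 + realDiag y).det‖ := by
    refine (PosSemidef.one.add ?_).norm_det_mono
      (PosDef.one.add_posSemidef (realDiag_posSemidef hy0)) ?_
    · have := (posSemidef_conjTranspose_mul_self W).mul_mul_conjTranspose_same r
      rwa [hrH] at this
    · have hidem : (1 - Wᴴ * W)ᴴ * (1 - Wᴴ * W) = 1 - Wᴴ * W := by
        have : Wᴴ * W * (Wᴴ * W) = Wᴴ * W := by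
          rw [Matrix.mul_assoc, ← Matrix.mul_assoc W, hW, Matrix.one_mul]
        simp [Matrix.sub_mul, Matrix.mul_sub, this]
      have := (posSemidef_conjTranspose_mul_self (1 - Wᴴ * W)).mul_mul_conjTranspose_same r
      rw [hidem, hrH, Matrix.mul_sub, Matrix.sub_mul, Matrix.mul_one, hrr] at this
      convert this using 1
      abel
  refine h1.trans (h2 ▸ h3.trans (le_of_eq ?_))
  rw [← realDiag_one, realDiag_add, norm_det_realDiag fun i => by linarith [hy0 i]]
  simp [hy]

lemma log_norm_det_compression_le {W : Matrix κ ι ℂ} (hW : W * Wᴴ = 1) {a : ι → ℝ}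
    (ha : ∀ i, 0 < a i) (hdet : (W * realDiag a * Wᴴ).det ≠ 0) (u : ℝ) :
    Real.log ‖(W * realDiag a * Wᴴ).det‖ + Fintype.card κ * u ≤
      ∑ i, max 0 (Real.log (a i) + u) := by
  have h := norm_det_compression_le hW (a := fun i => Real.exp u * a i)
    (fun i => by have := ha i; positivity)
  rw [← smul_realDiag, Matrix.mul_smul, Matrix.smul_mul, ← algebraMap_smul ℂ, det_smul, norm_mul,
    norm_pow] at h
  have hd : 0 < ‖(W * realDiag a * Wᴴ).det‖ := norm_pos_iff.2 hdet
  have hexp : ‖(algebraMap ℝ ℂ) (Real.exp u)‖ = Real.exp u := by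
    rw [norm_algebraMap', Real.norm_eq_abs, Real.abs_exp]
  rw [hexp] at h
  have h' := Real.log_le_log (by positivity) h
  rw [Real.log_mul (by positivity) hd.ne', Real.log_pow, Real.log_exp,
    Real.log_prod fun i _ => (lt_max_of_lt_left one_pos).ne'] at h'
  rw [add_comm]
  refine h'.trans (le_of_eq (Finset.sum_congr rfl fun i _ => ?_))
  have h0 : 0 < Real.exp u * a i := mul_pos (Real.exp_pos u) (ha i)
  have h1 : Real.log (a i) + u = Real.log (Real.exp u * a i) := by
    rw [Real.log_mul (Real.exp_ne_zero _) (ha i).ne', Real.log_exp, add_comm]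
  rw [h1, ← Real.posLog_apply, Real.posLog_eq_log_max_one h0.le]

/-- Weak log-majorization of the weighted geometric mean of two positive definite matrices
`T Tᴴ` and `T diag(l) Tᴴ`, in the form of an inequality between shifted positive parts. -/
lemma sum_max_log_geomMean_le {T U U' E : Matrix ι ι ℂ} {l a b g : ι → ℝ} (hT : IsUnit T.det)
    (hl : ∀ i, 0 < l i) (hU : U * Uᴴ = 1) (hU' : U' * U'ᴴ = 1)
    (hE' : Eᴴ * E = 1) (ha : ∀ i, 0 < a i) (hb : ∀ i, 0 < b i) (hg : ∀ i, 0 < g i) {t : ℝ}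
    (ht : t ∈ Set.Icc (0 : ℝ) 1) (hA : T * Tᴴ = U * realDiag a * Uᴴ)
    (hB : T * realDiag l * Tᴴ = U' * realDiag b * U'ᴴ)
    (hG : T * realDiag (fun i => l i ^ t) * Tᴴ = E * realDiag g * Eᴴ) (u v : ℝ) :
    ∑ i, max 0 (Real.log (g i) + ((1 - t) * u + t * v)) ≤
      (1 - t) * ∑ i, max 0 (Real.log (a i) + u) + t * ∑ i, max 0 (Real.log (b i) + v) := by
  classical
  set z := (1 - t) * u + t * v with hz
  let κ' := {i // 0 < Real.log (g i) + z}
  set J : Matrix ι κ' ℂ := (1 : Matrix ι ι ℂ).submatrix id (fun i : κ' => (i : ι)) with hJ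
  have hJD : ∀ f : ι → ℝ, Jᴴ * realDiag f * J = realDiag fun i : κ' => f i := fun f => by
    ext i j
    simp [hJ, realDiag, mul_apply, one_apply, diagonal_apply]
    aesop
  obtain ⟨V, hV⟩ : ∃ V, V = E * J := ⟨_, rfl⟩
  have hVV : Vᴴ * V = 1 := by
    have := hJD fun _ => 1
    rw [realDiag_one, realDiag_one, Matrix.mul_one] at this
    rw [hV, conjTranspose_mul, Matrix.mul_assoc, ← Matrix.mul_assoc Eᴴ, hE', Matrix.one_mul, this]
  have hinj : Function.Injective V.mulVec := fun x y hxy => by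
    have := congrArg (Vᴴ.mulVec) hxy
    simpa [mulVec_mulVec, hVV] using this
  have hTD : ∀ {f : ι → ℝ}, (∀ i, 0 < f i) →
      (Vᴴ * T * realDiag f * (Vᴴ * T)ᴴ).PosDef := fun {f} hf => by
    have := ((realDiag_posDef hf).conj_of_isUnit_det hT).conjTranspose_mul_mul_same hinj
    simpa [conjTranspose_mul, Matrix.mul_assoc] using this
  have hQ := hTD hl
  have hP := hTD (f := fun _ => 1) fun _ => one_pos
  rw [realDiag_one, Matrix.mul_one] at hP
  have hmain := norm_det_conj_rpow_le (Vᴴ * T) hl hP hQ ht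
  have hre : ∀ D : Matrix ι ι ℂ, Vᴴ * T * D * (Vᴴ * T)ᴴ = Vᴴ * (T * D * Tᴴ) * V := fun D => by
    simp [conjTranspose_mul, Matrix.mul_assoc]
  have hcompr : ∀ (X : Matrix ι ι ℂ) (f : ι → ℝ), Vᴴ * (X * realDiag f * Xᴴ) * V =
      Vᴴ * X * realDiag f * (Vᴴ * X)ᴴ := fun X f => by
    simp [conjTranspose_mul, Matrix.mul_assoc]
  have hiso : ∀ X : Matrix ι ι ℂ, X * Xᴴ = 1 → Vᴴ * X * (Vᴴ * X)ᴴ = 1 := fun X hX => by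
    rw [conjTranspose_mul, Matrix.mul_assoc, ← Matrix.mul_assoc X, hX, Matrix.one_mul,
      conjTranspose_conjTranspose, hVV]
  have hGd : Vᴴ * T * realDiag (fun i => l i ^ t) * (Vᴴ * T)ᴴ = realDiag fun i : κ' => g i := by
    rw [hre, hG, ← hJD g, hV, conjTranspose_mul]
    calc _ = Jᴴ * (Eᴴ * E) * realDiag g * (Eᴴ * E) * J := by simp only [Matrix.mul_assoc]
      _ = _ := by rw [hE', Matrix.mul_one, Matrix.mul_one]
  have hPe : Vᴴ * T * (Vᴴ * T)ᴴ = Vᴴ * U * realDiag a * (Vᴴ * U)ᴴ := by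
    have := hre 1
    rw [Matrix.mul_one, Matrix.mul_one] at this
    rw [this, hA, hcompr]
  have hQe : Vᴴ * T * realDiag l * (Vᴴ * T)ᴴ = Vᴴ * U' * realDiag b * (Vᴴ * U')ᴴ := by
    rw [hre, hB, hcompr]
  have hPd := hP.isUnit
  have hQd := hQ.isUnit
  rw [isUnit_iff_isUnit_det] at hPd hQd
  rw [hGd, norm_det_realDiag fun i => (hg _).le] at hmain
  have hlog := Real.log_le_log (Finset.prod_pos fun i _ => hg _) hmain
  have hp : 0 < ‖(Vᴴ * T * (Vᴴ * T)ᴴ).det‖ := norm_pos_iff.2 hPd.ne_zero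
  have hq : 0 < ‖(Vᴴ * T * realDiag l * (Vᴴ * T)ᴴ).det‖ := norm_pos_iff.2 hQd.ne_zero
  rw [Real.log_prod fun i _ => (hg _).ne', Real.log_mul (by positivity) (by positivity),
    Real.log_rpow hp, Real.log_rpow hq] at hlog
  have hLA := log_norm_det_compression_le (hiso U hU) ha (hPe ▸ hPd.ne_zero) u
  have hLB := log_norm_det_compression_le (hiso U' hU') hb (hQe ▸ hQd.ne_zero) v
  rw [← hPe] at hLA
  rw [← hQe] at hLB
  have hsum : ∑ i, max 0 (Real.log (g i) + z) =
      ∑ i : κ', Real.log (g i) + Fintype.card κ' * z := by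
    have h1 : ∀ i, max 0 (Real.log (g i) + z) =
        if 0 < Real.log (g i) + z then Real.log (g i) + z else 0 := fun i => by
      split_ifs with h
      · exact max_eq_right h.le
      · exact max_eq_left (not_lt.1 h)
    simp only [h1]
    rw [← Finset.sum_filter, Finset.sum_subtype (p := fun i => 0 < Real.log (g i) + z)
      (F := inferInstanceAs (Fintype κ')) _ (by simp),
      Finset.sum_add_distrib]
    simp [κ']
  have h1t : 0 ≤ 1 - t := by linarith [ht.2]
  have e1 := mul_le_mul_of_nonneg_left hLA h1t
  have e2 := mul_le_mul_of_nonneg_left hLB ht.1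
  have hzn : ∀ n : ℝ, n * z = (1 - t) * (n * u) + t * (n * v) := fun n => by rw [hz]; ring
  rw [hsum, hzn]
  linarith

end DeterminantInequalities

section ExponentialTransform

open MeasureTheory

lemma integrable_max_zero_mul_exp_neg : Integrable fun w : ℝ => max 0 w * Real.exp (-w) := by
  have h := (integrable_indicator_iff measurableSet_Ioi).2
    (Real.GammaIntegral_convergent (s := 2) two_pos)
  refine h.congr (Filter.Eventually.of_forall fun w => ?_)
  by_cases hw : 0 < w
  · simp only [Set.indicator_of_mem (Set.mem_Ioi.2 hw), max_eq_right hw.le]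
    norm_num [mul_comm]
  · simp [Set.indicator_of_notMem (show w ∉ Set.Ioi 0 from hw), max_eq_left (not_lt.1 hw)]

lemma integral_max_zero_mul_exp_neg : ∫ w : ℝ, max 0 w * Real.exp (-w) = 1 := by
  have h1 : Real.Gamma 2 = 1 := Real.Gamma_two
  rw [Real.Gamma_eq_integral two_pos, ← integral_indicator measurableSet_Ioi] at h1
  rw [← h1]
  congr 1
  funext w
  by_cases hw : 0 < w
  · simp only [Set.indicator_of_mem (Set.mem_Ioi.2 hw), max_eq_right hw.le]
    norm_num [mul_comm]
  · simp [Set.indicator_of_notMem (show w ∉ Set.Ioi 0 from hw), max_eq_left (not_lt.1 hw)]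

lemma max_zero_add_mul_exp_neg (x w : ℝ) : max 0 (x + w) * Real.exp (-w) =
    Real.exp x * (max 0 (w + x) * Real.exp (-(w + x))) := by
  rw [mul_left_comm, ← Real.exp_add, add_comm x w]
  congr 2
  ring

lemma integrable_max_zero_add_mul_exp_neg (x : ℝ) :
    Integrable fun w : ℝ => max 0 (x + w) * Real.exp (-w) := by
  simp only [max_zero_add_mul_exp_neg]
  exact (integrable_max_zero_mul_exp_neg.comp_add_right x).const_mul _

lemma integral_max_zero_add_mul_exp_neg (x : ℝ) :
    ∫ w : ℝ, max 0 (x + w) * Real.exp (-w) = Real.exp x := by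
  simp only [max_zero_add_mul_exp_neg]
  rw [integral_const_mul,
    integral_add_right_eq_self (fun w : ℝ => max 0 w * Real.exp (-w)) x,
    integral_max_zero_mul_exp_neg, mul_one]

variable {ι : Type*} [Fintype ι]

lemma integrable_sum_max_zero_add_mul_exp_neg (c : ℝ) (x : ι → ℝ) :
    Integrable fun w : ℝ => (c * ∑ i, max 0 (x i + w)) * Real.exp (-w) := by
  simp only [mul_assoc, Finset.sum_mul]
  exact (integrable_finsetSum _ fun i _ => integrable_max_zero_add_mul_exp_neg (x i)).const_mul _

lemma integral_sum_max_zero_add_mul_exp_neg (c : ℝ) (x : ι → ℝ) :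
    ∫ w : ℝ, (c * ∑ i, max 0 (x i + w)) * Real.exp (-w) = c * ∑ i, Real.exp (x i) := by
  simp only [mul_assoc, Finset.sum_mul]
  rw [integral_const_mul,
    integral_finsetSum _ fun i _ => integrable_max_zero_add_mul_exp_neg (x i)]
  simp only [integral_max_zero_add_mul_exp_neg]

lemma sum_exp_le_of_sum_max_zero_add_le {x y z : ι → ℝ} {c p q : ℝ}
    (h : ∀ w, c * ∑ i, max 0 (z i + w) ≤
      p * ∑ i, max 0 (x i + w) + q * ∑ i, max 0 (y i + w)) :
    c * ∑ i, Real.exp (z i) ≤ p * ∑ i, Real.exp (x i) + q * ∑ i, Real.exp (y i) := by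
  rw [← integral_sum_max_zero_add_mul_exp_neg, ← integral_sum_max_zero_add_mul_exp_neg,
    ← integral_sum_max_zero_add_mul_exp_neg, ← integral_add
      (integrable_sum_max_zero_add_mul_exp_neg _ _) (integrable_sum_max_zero_add_mul_exp_neg _ _)]
  refine integral_mono (integrable_sum_max_zero_add_mul_exp_neg _ _)
    ((integrable_sum_max_zero_add_mul_exp_neg _ _).add
      (integrable_sum_max_zero_add_mul_exp_neg _ _)) fun w => ?_
  simp only [← add_mul]
  exact mul_le_mul_of_nonneg_right (h w) (Real.exp_pos _).le

/-- Hölder-type trace inequality for the weighted geometric mean of powers of two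
positive definite matrices of unit trace. -/
lemma sum_rpow_geomMean_le_one [DecidableEq ι] {T U U' E : Matrix ι ι ℂ} {l s r g : ι → ℝ}
    (hT : IsUnit T.det) (hl : ∀ i, 0 < l i) (hU : U * Uᴴ = 1) (hU' : U' * U'ᴴ = 1)
    (hE : Eᴴ * E = 1) (hs : ∀ i, 0 < s i) (hr : ∀ i, 0 < r i) (hg : ∀ i, 0 < g i)
    (hs1 : ∑ i, s i = 1) (hr1 : ∑ i, r i = 1) {t p q c : ℝ}
    (ht : t ∈ Set.Icc (0 : ℝ) 1) (hp : 0 < p) (hq : 0 < q) (hc : c = (1 - t) * p + t * q)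
    (hc0 : 0 < c) (hA : T * Tᴴ = U * realDiag (fun i => s i ^ p) * Uᴴ)
    (hB : T * realDiag l * Tᴴ = U' * realDiag (fun i => r i ^ q) * U'ᴴ)
    (hG : T * realDiag (fun i => l i ^ t) * Tᴴ = E * realDiag g * Eᴴ) :
    ∑ i, g i ^ (1 / c) ≤ 1 := by
  have hscale : ∀ {k : ℝ}, 0 < k → ∀ (x : ι → ℝ) (w : ℝ),
      ∑ i, max 0 (k * x i + k * w) = k * ∑ i, max 0 (x i + w) := fun {k} hk x w => by
    rw [Finset.mul_sum]
    refine Finset.sum_congr rfl fun i _ => ?_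
    rw [mul_max_of_nonneg _ _ hk.le, mul_zero, mul_add]
  have h := sum_exp_le_of_sum_max_zero_add_le (x := fun i => Real.log (s i))
    (y := fun i => Real.log (r i)) (z := fun i => Real.log (g i) / c) (c := c)
    (p := (1 - t) * p) (q := t * q) fun w => by
      have := sum_max_log_geomMean_le hT hl hU hU' hE (fun i => Real.rpow_pos_of_pos (hs i) p)
        (fun i => Real.rpow_pos_of_pos (hr i) q) hg ht hA hB hG (p * w) (q * w)
      simp only [Real.log_rpow (hs _), Real.log_rpow (hr _), hscale hp, hscale hq] at this
      rw [← hscale hc0, mul_assoc, mul_assoc]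
      refine le_trans (le_of_eq (Finset.sum_congr rfl fun i _ => ?_)) this
      rw [mul_div_cancel₀ _ hc0.ne', hc]
      congr 1
      ring
  simp only [Real.exp_log (hs _), Real.exp_log (hr _), hs1, hr1, mul_one, ← hc] at h
  have h2 : ∑ i, g i ^ (1 / c) = ∑ i, Real.exp (Real.log (g i) / c) :=
    Finset.sum_congr rfl fun i _ => by rw [Real.rpow_def_of_pos (hg i), mul_one_div]
  rw [h2]
  exact le_of_mul_le_mul_left (by linarith) hc0

end ExponentialTransform

section TensorPower

variable {d m : ℕ}

lemma tensPow_mul (A B : Matrix (Fin d) (Fin d) ℂ) :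
    tensPow (A * B) m = tensPow A m * tensPow B m := by
  ext x y
  simp only [tensPow, mul_apply, Finset.prod_univ_sum, Fintype.piFinset_univ,
    Finset.prod_mul_distrib]

lemma tensPow_conjTranspose (A : Matrix (Fin d) (Fin d) ℂ) :
    tensPow Aᴴ m = (tensPow A m)ᴴ := by
  ext x y
  simp [tensPow, conjTranspose_apply]

lemma tensPow_realDiag (a : Fin d → ℝ) :
    tensPow (realDiag a) m = realDiag fun x : Fin m → Fin d => ∏ j, a (x j) := by
  ext x y
  by_cases h : x = y
  · subst h
    simp [tensPow, realDiag]
  · obtain ⟨j, hj⟩ := Function.ne_iff.1 h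
    rw [show realDiag (fun x : Fin m → Fin d => ∏ j, a (x j)) x y = 0 from diagonal_apply_ne _ h]
    exact Finset.prod_eq_zero (Finset.mem_univ j) (diagonal_apply_ne _ hj)

lemma tensPow_one : tensPow (1 : Matrix (Fin d) (Fin d) ℂ) m = 1 := by
  rw [← realDiag_one, tensPow_realDiag]
  simp [realDiag_one]

lemma tensPow_conj_realDiag (S : Matrix (Fin d) (Fin d) ℂ) (a : Fin d → ℝ) :
    tensPow (S * realDiag a * Sᴴ) m =
      tensPow S m * realDiag (fun x : Fin m → Fin d => ∏ j, a (x j)) * (tensPow S m)ᴴ := by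
  rw [tensPow_mul, tensPow_mul, tensPow_conjTranspose, tensPow_realDiag]

lemma mpow_tensPow {U : Matrix (Fin d) (Fin d) ℂ} (h1 : U * Uᴴ = 1) (h2 : Uᴴ * U = 1)
    {a : Fin d → ℝ} (ha : ∀ i, 0 ≤ a i) (r : ℝ) :
    mpow (tensPow (U * realDiag a * Uᴴ) m) r =
      tensPow (U * realDiag (fun i => a i ^ r) * Uᴴ) m := by
  have h1' : tensPow U m * (tensPow U m)ᴴ = 1 := by
    rw [← tensPow_conjTranspose, ← tensPow_mul, h1, tensPow_one]
  have h2' : (tensPow U m)ᴴ * tensPow U m = 1 := by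
    rw [← tensPow_conjTranspose, ← tensPow_mul, h2, tensPow_one]
  rw [tensPow_conj_realDiag, tensPow_conj_realDiag, mpow_conj_realDiag h1' h2']
  simp only [Real.finsetProd_rpow _ _ fun i _ => ha _]

lemma tensPow_smul (c : ℝ) (A : Matrix (Fin d) (Fin d) ℂ) :
    tensPow (c • A) m = c ^ m • tensPow A m := by
  ext x y
  simp [tensPow, Finset.prod_mul_distrib]

end TensorPower

section TraceInequality

variable {ι : Type*} [Fintype ι]

lemma trR_smul (c : ℝ) (A : Matrix ι ι ℂ) : trR (c • A) = c * trR A := by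
  simp [trR, trace_smul]

variable [DecidableEq ι]

lemma trR_conj_mul_conj (U S : Matrix ι ι ℂ) (r l : ι → ℝ) :
    trR (U * realDiag r * Uᴴ * (S * realDiag l * Sᴴ)) =
      ∑ z : ι × ι, (r z.1 * ‖(Uᴴ * S) z.1 z.2‖ ^ 2) * l z.2 := by
  have h : (U * realDiag r * Uᴴ * (S * realDiag l * Sᴴ)).trace =
      (realDiag r * ((Uᴴ * S) * realDiag l * (Uᴴ * S)ᴴ)).trace := by
    rw [conjTranspose_mul, conjTranspose_conjTranspose]
    calc _ = (U * (realDiag r * Uᴴ * (S * realDiag l * Sᴴ))).trace := by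
          simp only [Matrix.mul_assoc]
      _ = _ := by rw [trace_mul_comm]; simp only [Matrix.mul_assoc]
  rw [trR, h, trace, Complex.re_sum, Fintype.sum_prod_type]
  refine Finset.sum_congr rfl fun i _ => ?_
  rw [diag_apply, realDiag, diagonal_mul, conj_realDiag_apply_self, Complex.re_ofReal_mul,
    Complex.ofReal_re, Finset.mul_sum]
  exact Finset.sum_congr rfl fun j _ => by ring

lemma trR_conj_mul_conj_nonneg (U S : Matrix ι ι ℂ) {r l : ι → ℝ} (hr : ∀ i, 0 ≤ r i)
    (hl : ∀ i, 0 ≤ l i) : 0 ≤ trR (U * realDiag r * Uᴴ * (S * realDiag l * Sᴴ)) := by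
  rw [trR_conj_mul_conj]
  exact Finset.sum_nonneg fun z _ => by have := hr z.1; have := hl z.2; positivity

lemma trR_conj_rpow_le (U S : Matrix ι ι ℂ) {r l : ι → ℝ} (hr : ∀ i, 0 ≤ r i)
    (hl : ∀ i, 0 ≤ l i) {t p q : ℝ} (ht : t ∈ Set.Icc (0 : ℝ) 1) (hp : 0 ≤ p) (hq : 0 ≤ q) :
    trR (U * realDiag (fun i => r i ^ ((1 - t) * p + t * q)) * Uᴴ *
        (S * realDiag (fun i => l i ^ t) * Sᴴ)) ≤
      trR (U * realDiag (fun i => r i ^ p) * Uᴴ * (S * Sᴴ)) ^ (1 - t) *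
        trR (U * realDiag (fun i => r i ^ q) * Uᴴ * (S * realDiag l * Sᴴ)) ^ t := by
  have hSS : S * Sᴴ = S * realDiag (fun _ => 1) * Sᴴ := by rw [realDiag_one, Matrix.mul_one]
  have h1t : 0 ≤ 1 - t := by linarith [ht.2]
  rw [hSS, trR_conj_mul_conj, trR_conj_mul_conj, trR_conj_mul_conj]
  refine le_trans (le_of_eq (Finset.sum_congr rfl fun z _ => ?_))
    (sum_rpow_mul_rpow_le _ (fun z => ?_) (fun z => ?_) ht)
  · have h1 := Real.rpow_nonneg (hr z.1) p
    have h2 := Real.rpow_nonneg (hr z.1) q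
    have h3 : 0 ≤ ‖(Uᴴ * S) z.1 z.2‖ ^ 2 := by positivity
    rw [mul_one, Real.mul_rpow h1 h3, Real.mul_rpow (by positivity) (hl _), Real.mul_rpow h2 h3,
      Real.rpow_add_of_nonneg (hr _) (mul_nonneg h1t hp) (mul_nonneg ht.1 hq),
      mul_comm _ p, mul_comm t q, Real.rpow_mul (hr _), Real.rpow_mul (hr _)]
    have h4 : ‖(Uᴴ * S) z.1 z.2‖ ^ 2 = (‖(Uᴴ * S) z.1 z.2‖ ^ 2) ^ (1 - t) *
        (‖(Uᴴ * S) z.1 z.2‖ ^ 2) ^ t := by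
      rw [← Real.rpow_add_of_nonneg h3 h1t ht.1]
      simp
    conv_lhs => rw [h4]
    ring
  · have := Real.rpow_nonneg (hr z.1) p
    positivity
  · have := Real.rpow_nonneg (hr z.1) q
    have := hl z.2
    positivity

end TraceInequality

section Interpolation

lemma inv_conj_realDiag {ι : Type*} [Fintype ι] [DecidableEq ι] (X : Matrix ι ι ℂ) {f : ι → ℝ}
    (hf : ∀ i, f i ≠ 0) :
    (X * realDiag f * Xᴴ)⁻¹ = X⁻¹ᴴ * realDiag (fun i => (f i)⁻¹) * X⁻¹ᴴᴴ := by
  have h : (realDiag f)⁻¹ = realDiag fun i => (f i)⁻¹ := inv_eq_right_inv (by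
    rw [realDiag_mul, ← realDiag_one]
    simp only [mul_inv_cancel₀ (hf _)])
  rw [Matrix.mul_inv_rev, Matrix.mul_inv_rev, h, conjTranspose_conjTranspose,
    conjTranspose_nonsing_inv, Matrix.mul_assoc]

lemma inv_conjTranspose_eq_self {ι : Type*} [Fintype ι] [DecidableEq ι] {U : Matrix ι ι ℂ}
    (h : U * Uᴴ = 1) : U⁻¹ᴴ = U := by
  rw [inv_eq_right_inv h, conjTranspose_conjTranspose]

lemma trace_conj_realDiag {ι : Type*} [Fintype ι] [DecidableEq ι] {U : Matrix ι ι ℂ}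
    (h : Uᴴ * U = 1) (a : ι → ℝ) : (U * realDiag a * Uᴴ).trace = ((∑ i, a i : ℝ) : ℂ) := by
  rw [trace_mul_comm, ← Matrix.mul_assoc, h, Matrix.one_mul, realDiag, trace_diagonal]
  push_cast
  rfl

variable {d m : ℕ}

lemma nonempty_dens (hd : 0 < d) : Nonempty (Dens d) := by
  have hd' : (0 : ℝ) < d := by exact_mod_cast hd
  refine ⟨⟨realDiag fun _ => (d : ℝ)⁻¹, realDiag_posDef fun _ => by positivity, ?_⟩⟩
  simp [realDiag, hd.ne']

lemma Dens.exists_unitary_realDiag (σ : Dens d) :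
    ∃ (U : Matrix (Fin d) (Fin d) ℂ) (s : Fin d → ℝ), U * Uᴴ = 1 ∧ Uᴴ * U = 1 ∧
      (∀ i, 0 < s i) ∧ ∑ i, s i = 1 ∧ σ.1 = U * realDiag s * Uᴴ := by
  obtain ⟨U, s, h1, h2, hs, hσ⟩ := σ.2.1.exists_unitary_realDiag
  refine ⟨U, s, h1, h2, hs, ?_, hσ⟩
  have := σ.2.2
  rw [hσ, trace_conj_realDiag h2] at this
  exact_mod_cast this

variable {ρ : Matrix (Fin m → Fin d) (Fin m → Fin d) ℂ}

lemma trR_mpow_mul_mpow_tensPow_nonneg (hρ : ρ.PosSemidef) (σ : Dens d) (β : ℝ) :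
    0 ≤ trR (mpow ρ β * mpow (tensPow σ.1 m) (1 - β)) := by
  obtain ⟨V, r, hV, hV', hr, hρV⟩ := hρ.exists_unitary_realDiag
  obtain ⟨U, s, hU, hU', hs, -, hσ⟩ := σ.exists_unitary_realDiag
  rw [hρV, mpow_conj_realDiag hV hV', hσ, mpow_tensPow hU hU' fun i => (hs i).le,
    tensPow_conj_realDiag]
  exact trR_conj_mul_conj_nonneg _ _ (fun i => Real.rpow_nonneg (hr i) _)
    fun x => Finset.prod_nonneg fun j _ => Real.rpow_nonneg (hs _).le _

lemma exists_dens_trR_le (hd : 0 < d) (hρ : ρ.PosSemidef) (σ₀ σ₁ : Dens d) {α₀ α₁ α t : ℝ}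
    (hα₀ : 1 < α₀) (hα₁ : 1 < α₁) (ht : t ∈ Set.Icc (0 : ℝ) 1)
    (hα : α = (1 - t) * α₀ + t * α₁) :
    ∃ σ : Dens d, trR (mpow ρ α * mpow (tensPow σ.1 m) (1 - α)) ≤
      trR (mpow ρ α₀ * mpow (tensPow σ₀.1 m) (1 - α₀)) ^ (1 - t) *
        trR (mpow ρ α₁ * mpow (tensPow σ₁.1 m) (1 - α₁)) ^ t := by
  obtain ⟨V, k, hV, hV', hk, hρV⟩ := hρ.exists_unitary_realDiag
  obtain ⟨U, s, hU, hU', hs, hs1, hσ₀⟩ := σ₀.exists_unitary_realDiag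
  obtain ⟨W, r, hW, hW', hr, hr1, hσ₁⟩ := σ₁.exists_unitary_realDiag
  have hsr : ∀ (x : ℝ) i, 0 < s i ^ x := fun x i => Real.rpow_pos_of_pos (hs i) x
  have hrr : ∀ (x : ℝ) i, 0 < r i ^ x := fun x i => Real.rpow_pos_of_pos (hr i) x
  have hunit : ∀ X : Matrix (Fin d) (Fin d) ℂ, X * Xᴴ = 1 → IsUnit X.det := fun X hX =>
    isUnit_det_of_posDef_mul_conjTranspose (hX ▸ PosDef.one)
  obtain ⟨S, l, hS, hl, hS0, hS1⟩ :=
    ((realDiag_posDef (hsr (1 - α₀))).conj_of_isUnit_det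
      (hunit U hU)).exists_simultaneous_congruence
    ((realDiag_posDef (hrr (1 - α₁))).conj_of_isUnit_det (hunit W hW))
  have hlt : ∀ i, 0 < l i ^ t := fun i => Real.rpow_pos_of_pos (hl i) t
  set T := S⁻¹ᴴ with hT
  have hTu : IsUnit T.det := by
    rw [hT, det_conjTranspose]
    exact (isUnit_nonsing_inv_det _ hS).star
  have hTS : T⁻¹ᴴ = S := by
    rw [hT, conjTranspose_nonsing_inv, conjTranspose_conjTranspose, nonsing_inv_nonsing_inv _ hS]
  have hA : T * Tᴴ = U * realDiag (fun i => s i ^ (α₀ - 1)) * Uᴴ := by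
    have h := inv_conj_realDiag S (f := fun _ => 1) fun _ => one_ne_zero
    simp only [inv_one, realDiag_one, Matrix.mul_one] at h
    rw [← h, ← hS0, inv_conj_realDiag U fun i => (hsr _ i).ne', inv_conjTranspose_eq_self hU]
    simp only [← Real.rpow_neg (hs _).le, neg_sub]
  have hB : T * realDiag (fun i => (l i)⁻¹) * Tᴴ =
      W * realDiag (fun i => r i ^ (α₁ - 1)) * Wᴴ := by
    rw [← inv_conj_realDiag S fun i => (hl i).ne', ← hS1,
      inv_conj_realDiag W fun i => (hrr _ i).ne', inv_conjTranspose_eq_self hW]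
    simp only [← Real.rpow_neg (hr _).le, neg_sub]
  have hlit : ∀ i, 0 < (l i)⁻¹ ^ t := fun i => Real.rpow_pos_of_pos (inv_pos.2 (hl i)) t
  obtain ⟨E, g, hE, hE', hg, hG⟩ :=
    ((realDiag_posDef hlit).conj_of_isUnit_det hTu).exists_unitary_realDiag
  have hω : S * realDiag (fun i => l i ^ t) * Sᴴ = E * realDiag (fun i => (g i)⁻¹) * Eᴴ := by
    have h := congrArg (fun X => X⁻¹) hG
    simp only [inv_conj_realDiag T fun i => (hlit i).ne', hTS,
      inv_conj_realDiag E fun i => (hg i).ne', inv_conjTranspose_eq_self hE] at h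
    rw [← h]
    simp only [Real.inv_rpow (hl _).le, inv_inv]
  set c := α - 1 with hc
  have hcp : c = (1 - t) * (α₀ - 1) + t * (α₁ - 1) := by rw [hc, hα]; ring
  have hc0 : 0 < c := by
    rcases ht.1.eq_or_lt with rfl | h
    · rw [hcp]; linarith
    · have e1 : 0 ≤ (1 - t) * (α₀ - 1) := mul_nonneg (by linarith [ht.2]) (by linarith)
      have e2 : 0 < t * (α₁ - 1) := mul_pos h (by linarith)
      linarith
  have hsum := sum_rpow_geomMean_le_one hTu (fun i => inv_pos.2 (hl i)) hU hW hE' hs hr hg hs1 hr1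
    ht (by linarith) (by linarith) hcp hc0 hA hB hG
  set z := ∑ i, g i ^ (1 / c) with hz
  have hgc : ∀ i, 0 < g i ^ (1 / c) := fun i => Real.rpow_pos_of_pos (hg i) _
  have hz0 : 0 < z := Finset.sum_pos (fun i _ => hgc i) ⟨⟨0, hd⟩, Finset.mem_univ _⟩
  have he : ∀ i, 0 < g i ^ (1 / c) / z := fun i => div_pos (hgc i) hz0
  refine ⟨⟨E * realDiag (fun i => g i ^ (1 / c) / z) * Eᴴ,
    (realDiag_posDef he).conj_of_isUnit_det (hunit E hE), ?_⟩, ?_⟩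
  · rw [trace_conj_realDiag hE', ← Finset.sum_div, ← hz, div_self hz0.ne', Complex.ofReal_one]
  have hpow : ∀ i, (g i ^ (1 / c) / z) ^ (1 - α) = z ^ c * (g i)⁻¹ := fun i => by
    rw [show 1 - α = -c by rw [hc]; ring, Real.rpow_neg (he i).le,
      Real.div_rpow (hgc i).le hz0.le, ← Real.rpow_mul (hg i).le, one_div_mul_cancel hc0.ne',
      Real.rpow_one, inv_div, div_eq_mul_inv]
  have hzc : (z ^ c) ^ m ≤ 1 :=
    pow_le_one₀ (Real.rpow_nonneg hz0.le _) (Real.rpow_le_one hz0.le hsum hc0.le)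
  simp only
  rw [mpow_tensPow hE hE' fun i => (he i).le]
  simp only [hpow]
  rw [← smul_realDiag, Matrix.mul_smul, Matrix.smul_mul, ← hω, tensPow_smul, Matrix.mul_smul,
    trR_smul, hσ₀, hσ₁, mpow_tensPow hU hU' fun i => (hs i).le,
    mpow_tensPow hW hW' fun i => (hr i).le, hS0, hS1, tensPow_conj_realDiag,
    tensPow_conj_realDiag, tensPow_mul S Sᴴ, tensPow_conjTranspose, hρV, mpow_conj_realDiag hV hV',
    mpow_conj_realDiag hV hV', mpow_conj_realDiag hV hV']
  have hprod : ∀ x : Fin m → Fin d, ∏ j, l (x j) ^ t = (∏ j, l (x j)) ^ t := fun x =>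
    Real.finsetProd_rpow _ _ (fun j _ => (hl _).le) t
  simp only [hprod]
  refine (mul_le_of_le_one_left (trR_conj_mul_conj_nonneg _ _
    (fun i => Real.rpow_nonneg (hk i) _) fun x =>
      Real.rpow_nonneg (Finset.prod_nonneg fun j _ => (hl _).le) _) hzc).trans ?_
  rw [hα]
  exact trR_conj_rpow_le V (tensPow S m) hk (fun x => Finset.prod_nonneg fun j _ => (hl _).le) ht
    (by linarith) (by linarith)

end Interpolation

/-- tensor-power interpolation inequality, Petz version. -/
theorem petz_tensor_power_interpolation {d m : ℕ} (hd : 0 < d) (hm : 0 < m)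
    (ρ : Matrix (Fin m → Fin d) (Fin m → Fin d) ℂ) (hρ : ρ.PosSemidef)
    (F : ℝ → ℝ)
    (hF : ∀ α : ℝ, F α = ⨅ σ : Dens d,
      trR (mpow ρ α * mpow (tensPow σ.1 m) (1 - α)) ^ (1 / α))
    (α₀ α₁ α θ : ℝ) (hα₀ : 1 < α₀) (hα₁ : 1 < α₁)
    (hθ : θ ∈ Set.Icc (0 : ℝ) 1)
    (hα : 1 / α = (1 - θ) / α₀ + θ / α₁) :
    F α ≤ F α₀ ^ (1 - θ) * F α₁ ^ θ := by
  have h0 : (0 : ℝ) < α₀ := by linarith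
  have h1 : (0 : ℝ) < α₁ := by linarith
  have hθ' : 0 ≤ 1 - θ := by linarith [hθ.2]
  have hαpos : 0 < α := by
    rw [← one_div_pos, hα]
    rcases hθ.1.eq_or_lt with rfl | h
    · simpa using h0
    · have : 0 ≤ (1 - θ) / α₀ := by positivity
      have : 0 < θ / α₁ := by positivity
      linarith
  set t := α * (θ / α₁) with ht
  have h1t : 1 - t = α * ((1 - θ) / α₀) := by
    have : α * (1 / α) = 1 := mul_one_div_cancel hαpos.ne'
    rw [hα] at this
    linarith
  have htI : t ∈ Set.Icc (0 : ℝ) 1 := by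
    have hθ0 := hθ.1
    have : 0 ≤ 1 - t := by rw [h1t]; positivity
    exact ⟨by positivity, by linarith⟩
  have hαt : α = (1 - t) * α₀ + t * α₁ := by
    rw [h1t, ht]
    field_simp
    ring
  have : Nonempty (Dens d) := nonempty_dens hd
  set f : ℝ → Dens d → ℝ := fun β σ =>
    trR (mpow ρ β * mpow (tensPow σ.1 m) (1 - β)) ^ (1 / β) with hf
  have htr : ∀ β (σ : Dens d), 0 ≤ trR (mpow ρ β * mpow (tensPow σ.1 m) (1 - β)) :=
    fun β σ => trR_mpow_mul_mpow_tensPow_nonneg hρ σ β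
  have hf0 : ∀ β σ, 0 ≤ f β σ := fun β σ => Real.rpow_nonneg (htr β σ) _
  have hbdd : ∀ β, BddBelow (Set.range (f β)) := fun β => ⟨0, by
    rintro _ ⟨σ, rfl⟩
    exact hf0 β σ⟩
  have hF' : ∀ β, F β = ⨅ σ, f β σ := hF
  have key : ∀ σ₀ σ₁, F α ≤ f α₀ σ₀ ^ (1 - θ) * f α₁ σ₁ ^ θ := fun σ₀ σ₁ => by
    obtain ⟨σ, hσ⟩ := exists_dens_trR_le hd hρ σ₀ σ₁ hα₀ hα₁ htI hαt
    rw [hF']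
    refine (ciInf_le (hbdd α) σ).trans ?_
    refine (Real.rpow_le_rpow (htr α σ) hσ (by positivity)).trans (le_of_eq ?_)
    rw [Real.mul_rpow (Real.rpow_nonneg (htr _ _) _) (Real.rpow_nonneg (htr _ _) _), hf]
    simp only [← Real.rpow_mul (htr _ _)]
    congr 2
    · rw [h1t]; field_simp
    · rw [ht]; field_simp
  have hlim : ∀ β, ∃ u : ℕ → Dens d, Filter.Tendsto (fun n => f β (u n)) Filter.atTop
      (nhds (F β)) := fun β => by
    obtain ⟨v, -, hv, hmem⟩ := exists_seq_tendsto_sInf (Set.range_nonempty (f β)) (hbdd β)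
    choose u hu using hmem
    refine ⟨u, ?_⟩
    rw [hF']
    exact hv.congr fun n => (hu n).symm
  obtain ⟨u, hu⟩ := hlim α₀
  obtain ⟨v, hv⟩ := hlim α₁
  exact ge_of_tendsto' ((hu.rpow_const (Or.inr hθ')).mul (hv.rpow_const (Or.inr hθ.1)))
    fun n => key (u n) (v n)
end
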